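/- The normalized logarithms of the negative continued fraction convergent denominators satisfy (log n / n) · log Q_n(x) → π²/6 in measure; that is, for every ε > 0, the Lebesgue measure of {x ∈ (0,1) irrational : |(log n / n) · log Q_n(x) − π²/6| > ε} tends to 0 as n → ∞. -/

import Mathlib

open MeasureTheory Filter Real

/-- The negative continued fraction map `T(y) = -1/y - ⌊-1/y⌋` (with `T 0 = 0`). -/
noncomputable def negT (y : ℝ) : ℝ := Int.fract (-1 / y)

/-- The `n`-th negative continued fraction digit `a'_n(x) = ⌈1 / T^{n-1}(1-x)⌉`. -/
noncomputable def negDigit (x : ℝ) (n : ℕ) : ℕ := (⌈1 / negT^[n - 1] (1 - x)⌉).toNat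

/-- Numerators of negative continued fraction convergents, shifted so that
`negP x (n+1) = P_n` with `P_{-1} = negP x 0 = 1`, `P_0 = negP x 1 = 1`,
`P_n = a'_n P_{n-1} - P_{n-2}`. -/
noncomputable def negP (x : ℝ) : ℕ → ℤ
  | 0 => 1
  | 1 => 1
  | n + 2 => negDigit x (n + 1) * negP x (n + 1) - negP x n

/-- Denominators of negative continued fraction convergents, shifted so that
`negQ x (n+1) = Q_n` with `Q_{-1} = negQ x 0 = 0`, `Q_0 = negQ x 1 = 1`,
`Q_n = a'_n Q_{n-1} - Q_{n-2}`. -/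
noncomputable def negQ (x : ℝ) : ℕ → ℤ
  | 0 => 0
  | 1 => 1
  | n + 2 => negDigit x (n + 1) * negQ x (n + 1) - negQ x n

/-- The Gauss map `x ↦ {1/x}` of regular continued fractions. -/
noncomputable def gaussMap (x : ℝ) : ℝ := Int.fract (1 / x)

theorem Irrational.fract {x : ℝ} (hx : Irrational x) : Irrational (Int.fract x) := by
  unfold Int.fract
  exact hx.sub_intCast _

theorem Irrational.one_div {x : ℝ} (hx : Irrational x) : Irrational (1 / x) := by
  simpa using hx.inv

theorem Irrational.fract_mem {x : ℝ} (hx : Irrational x) : Int.fract x ∈ Set.Ioo (0 : ℝ) 1 :=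
  ⟨lt_of_le_of_ne (Int.fract_nonneg x) (fun h => hx.fract ⟨0, by simpa using h⟩),
    Int.fract_lt_one x⟩

theorem irrational_gaussMap_iterate {x : ℝ} (hx : x ∈ Set.Ioo (0 : ℝ) 1) (hi : Irrational x)
    (n : ℕ) : gaussMap^[n] x ∈ Set.Ioo (0 : ℝ) 1 ∧ Irrational (gaussMap^[n] x) := by
  induction n with
  | zero => exact ⟨hx, hi⟩
  | succ n ih =>
    rw [Function.iterate_succ_apply']
    exact ⟨ih.2.one_div.fract_mem, ih.2.one_div.fract⟩

theorem irrational_negT_iterate {y : ℝ} (hy : y ∈ Set.Ioo (0 : ℝ) 1) (hi : Irrational y)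
    (n : ℕ) : negT^[n] y ∈ Set.Ioo (0 : ℝ) 1 ∧ Irrational (negT^[n] y) := by
  induction n with
  | zero => exact ⟨hy, hi⟩
  | succ n ih =>
    rw [Function.iterate_succ_apply']
    have h : Irrational (-1 / negT^[n] y) := by
      rw [neg_div]; exact ih.2.one_div.neg
    exact ⟨h.fract_mem, h.fract⟩

theorem negDigit_eq {x : ℝ} (hx : x ∈ Set.Ioo (0 : ℝ) 1) (hi : Irrational x) (n : ℕ) :
    (negDigit x (n + 1) : ℝ) = 1 / negT^[n] (1 - x) + negT^[n + 1] (1 - x) ∧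
      2 ≤ negDigit x (n + 1) := by
  have hy : 1 - x ∈ Set.Ioo (0 : ℝ) 1 := ⟨by linarith [hx.2], by linarith [hx.1]⟩
  have hyi : Irrational (1 - x) := by simpa using hi.natCast_sub 1
  obtain ⟨⟨h0, h1⟩, -⟩ := irrational_negT_iterate hy hyi n
  rw [Function.iterate_succ_apply']
  unfold negDigit
  rw [Nat.add_sub_cancel]
  set z := negT^[n] (1 - x) with hz
  have hz1 : 1 < 1 / z := by rw [lt_div_iff₀ h0]; linarith
  have hc : (1 : ℤ) < ⌈1 / z⌉ := by rw [Int.lt_ceil]; exact_mod_cast hz1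
  have hc' : ((⌈1 / z⌉.toNat : ℤ)) = ⌈1 / z⌉ := Int.toNat_of_nonneg (by omega)
  refine ⟨?_, by omega⟩
  have hc2 : ((⌈1 / z⌉.toNat : ℝ)) = (⌈1 / z⌉ : ℝ) := by exact_mod_cast hc'
  rw [hc2, negT, neg_div, Int.fract, Int.floor_neg]
  push_cast
  ring

theorem log_negQ_bounds {x : ℝ} (hx : x ∈ Set.Ioo (0 : ℝ) 1) (hi : Irrational x) (n : ℕ) :
    birkhoffSum negT (fun y => -Real.log y) n (1 - x) ≤ Real.log (negQ x (n + 1)) ∧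
    Real.log (negQ x (n + 1)) ≤
      birkhoffSum negT (fun y => -Real.log y) n (1 - x) + Real.log (n + 1) := by
  have hy : 1 - x ∈ Set.Ioo (0 : ℝ) 1 := ⟨by linarith [hx.2], by linarith [hx.1]⟩
  have hyi : Irrational (1 - x) := by simpa using hi.natCast_sub 1
  have key : ∀ n : ℕ, 0 ≤ negQ x n ∧ 1 ≤ negQ x (n + 1) - negQ x n ∧
      negQ x (n + 1) ≤ (n + 1) * (negQ x (n + 1) - negQ x n) := by
    intro n
    induction n with
    | zero => simp [negQ]
    | succ n ih =>
      obtain ⟨h0, h1, h2⟩ := ih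
      have hd : (2 : ℤ) ≤ negDigit x (n + 1) := by exact_mod_cast (negDigit_eq hx hi n).2
      have e : negQ x (n + 2) = negDigit x (n + 1) * negQ x (n + 1) - negQ x n := rfl
      have hle : 2 * negQ x (n + 1) - negQ x n ≤ negQ x (n + 2) := by
        rw [e]; nlinarith
      refine ⟨by linarith, by linarith, ?_⟩
      push_cast
      have : ((n : ℤ) + 1) * (negQ x (n + 1) - negQ x n) ≤
          ((n : ℤ) + 1) * (negQ x (n + 2) - negQ x (n + 1)) :=
        mul_le_mul_of_nonneg_left (by linarith) (by positivity)
      change negQ x (n + 2) ≤ (n + 1 + 1) * (negQ x (n + 2) - negQ x (n + 1))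
      linarith
  have hD : ∀ n : ℕ, 0 < (negQ x (n + 1) : ℝ) - negT^[n] (1 - x) * negQ x n ∧
      Real.log ((negQ x (n + 1) : ℝ) - negT^[n] (1 - x) * negQ x n) =
        birkhoffSum negT (fun y => -Real.log y) n (1 - x) := by
    intro n
    induction n with
    | zero => simp [negQ]
    | succ n ih =>
      obtain ⟨ih0, ih1⟩ := ih
      obtain ⟨⟨h0, h1⟩, -⟩ := irrational_negT_iterate hy hyi n
      have e : (negQ x (n + 1 + 1) : ℝ) - negT^[n + 1] (1 - x) * negQ x (n + 1) =
          ((negQ x (n + 1) : ℝ) - negT^[n] (1 - x) * negQ x n) / negT^[n] (1 - x) := by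
        have e1 : negQ x (n + 1 + 1) = negDigit x (n + 1) * negQ x (n + 1) - negQ x n := rfl
        rw [e1]
        push_cast
        rw [(negDigit_eq hx hi n).1]
        field_simp
        ring
      rw [e, birkhoffSum_succ, ← ih1, Real.log_div ih0.ne' h0.ne']
      exact ⟨div_pos ih0 h0, by ring⟩
  obtain ⟨hp, hl⟩ := hD n
  obtain ⟨k0, k1, k2⟩ := key n
  obtain ⟨⟨h0, h1⟩, -⟩ := irrational_negT_iterate hy hyi n
  have k0' : (0 : ℝ) ≤ negQ x n := by exact_mod_cast k0
  have k2' : (negQ x (n + 1) : ℝ) ≤ (n + 1) * (negQ x (n + 1) - negQ x n) := by exact_mod_cast k2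
  have hQ : (0 : ℝ) < negQ x (n + 1) := by
    have : 0 < negQ x (n + 1) := by linarith
    exact_mod_cast this
  rw [← hl]
  constructor
  · exact Real.log_le_log hp (by nlinarith)
  · rw [← Real.log_mul hp.ne' (by positivity)]
    refine Real.log_le_log hQ (k2'.trans ?_)
    rw [mul_comm]
    gcongr
    nlinarith

theorem negT_excursion (m : ℕ) : ∀ {x : ℝ}, x ∈ Set.Ioo (0 : ℝ) 1 → Irrational x →
    ⌊1 / x⌋₊ = m → negT^[m] (1 - x) = 1 - gaussMap (gaussMap x) ∧
    birkhoffSum negT (fun y => -Real.log y) m (1 - x) =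
      -Real.log x + -Real.log (gaussMap x) := by
  induction m with
  | zero =>
    intro x hx _ hm
    rw [Nat.floor_eq_zero, div_lt_one hx.1] at hm
    linarith [hx.2]
  | succ m ih =>
    intro x hx hi hm
    obtain ⟨h0, h1⟩ := hx
    have h1' : 0 < 1 - x := by linarith
    have hne : x ≠ 1 / 2 := fun h => hi ⟨1 / 2, by rw [h]; norm_num⟩
    rw [Function.iterate_succ_apply, birkhoffSum_succ']
    rcases lt_or_gt_of_ne hne with hlt | hgt
    · have hz : x / (1 - x) ∈ Set.Ioo (0 : ℝ) 1 :=
        ⟨by positivity, by rw [div_lt_one h1']; linarith⟩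
      have hdiv : 1 / (x / (1 - x)) = 1 / x - 1 := by field_simp
      have hzi : Irrational (x / (1 - x)) := by
        have h := (hi.one_div.sub_natCast 1).one_div
        push_cast at h
        rwa [← hdiv, one_div_one_div] at h
      have hT : negT (1 - x) = 1 - x / (1 - x) := by
        rw [negT, Int.fract_eq_iff]
        refine ⟨by linarith [hz.2], by linarith [hz.1], -2, ?_⟩
        push_cast
        field_simp
        ring
      have hG : gaussMap (x / (1 - x)) = gaussMap x := by
        rw [gaussMap, hdiv, Int.fract_sub_one, gaussMap]
      obtain ⟨i1, i2⟩ := ih hz hzi (by rw [hdiv, Nat.floor_sub_one, hm]; rfl)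
      rw [hT, i1, i2, hG, Real.log_div h0.ne' h1'.ne']
      exact ⟨rfl, by ring⟩
    · have hfl : ⌊1 / x⌋ = 1 := by
        rw [Int.floor_eq_iff]
        push_cast
        constructor
        · rw [le_div_iff₀ h0]; linarith
        · rw [div_lt_iff₀ h0]; linarith
      have hm0 : m = 0 := by
        have : ⌊1 / x⌋₊ = 1 := by
          rw [← Int.floor_toNat, hfl]; rfl
        omega
      have hG : gaussMap x = (1 - x) / x := by
        rw [gaussMap, Int.fract, hfl]
        push_cast
        field_simp
      have hGi : Irrational (1 / gaussMap x) := hi.one_div.fract.one_div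
      subst hm0
      have hT : negT (1 - x) = 1 - gaussMap (gaussMap x) := by
        have e : -1 / (1 - x) = -(1 / gaussMap x) - 1 := by
          rw [hG]; field_simp; ring
        rw [negT, e, Int.fract_sub_one, Int.fract_neg hGi.fract_mem.1.ne', ← gaussMap]
      rw [hT, hG, Real.log_div h1'.ne' h0.ne']
      simp only [Function.iterate_zero, id_eq, birkhoffSum_zero, true_and]
      ring

/-- The number of negative continued fraction digits read off while the regular continued
fraction advances by `2 * k` digits. -/
noncomputable def excursionTime (k : ℕ) (x : ℝ) : ℕ :=
  ∑ i ∈ Finset.range k, ⌊1 / gaussMap^[2 * i] x⌋₊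

theorem birkhoffSum_excursionTime {x : ℝ} (hx : x ∈ Set.Ioo (0 : ℝ) 1) (hi : Irrational x)
    (k : ℕ) : negT^[excursionTime k x] (1 - x) = 1 - gaussMap^[2 * k] x ∧
    birkhoffSum negT (fun y => -Real.log y) (excursionTime k x) (1 - x) =
      ∑ j ∈ Finset.range (2 * k), -Real.log (gaussMap^[j] x) := by
  induction k with
  | zero => simp [excursionTime]
  | succ k ih =>
    have e : excursionTime (k + 1) x = excursionTime k x + ⌊1 / gaussMap^[2 * k] x⌋₊ := by
      rw [excursionTime, Finset.sum_range_succ, excursionTime]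
    obtain ⟨hk, hki⟩ := irrational_gaussMap_iterate hx hi (2 * k)
    obtain ⟨h1, h2⟩ := negT_excursion _ hk hki rfl
    rw [e, birkhoffSum_add, add_comm, Function.iterate_add_apply, ih.1, ih.2, h1, h2, mul_add_one,
      Finset.sum_range_succ, Finset.sum_range_succ, Function.iterate_succ_apply',
      Function.iterate_succ_apply', add_assoc]
    exact ⟨rfl, rfl⟩

theorem birkhoffSum_negT_mono {x : ℝ} (hx : x ∈ Set.Ioo (0 : ℝ) 1) (hi : Irrational x) :
    Monotone (fun n => birkhoffSum negT (fun y => -Real.log y) n (1 - x)) := by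
  have hy : 1 - x ∈ Set.Ioo (0 : ℝ) 1 := ⟨by linarith [hx.2], by linarith [hx.1]⟩
  have hyi : Irrational (1 - x) := by simpa using hi.natCast_sub 1
  refine monotone_nat_of_le_succ fun n => ?_
  obtain ⟨⟨h0, h1⟩, -⟩ := irrational_negT_iterate hy hyi n
  rw [birkhoffSum_succ]
  linarith [Real.log_neg h0 h1]

open scoped ENNReal

/-- The weights of the Gauss transfer operator, indexed by the first digit minus one. -/
noncomputable def gaussWeight (a : ℕ) (x : ℝ) : ℝ := (1 + x) / ((a + 1 + x) * (a + 2 + x))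

/-- The inverse branches of the Gauss map. -/
noncomputable def gaussBranch (a : ℕ) (x : ℝ) : ℝ := 1 / (a + 1 + x)

/-- The transfer operator of the Gauss map with respect to the Gauss measure. -/
noncomputable def gaussTransfer (h : ℝ → ℝ) (x : ℝ) : ℝ :=
  ∑' a, gaussWeight a x * h (gaussBranch a x)

theorem gaussWeight_nonneg (a : ℕ) {x : ℝ} (hx : 0 ≤ x) : 0 ≤ gaussWeight a x := by
  unfold gaussWeight; positivity

theorem sum_gaussWeight (n : ℕ) {x : ℝ} (hx : 0 ≤ x) :
    ∑ a ∈ Finset.range n, gaussWeight a x = n / (n + 1 + x) := by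
  induction n with
  | zero => simp
  | succ n ih =>
    rw [Finset.sum_range_succ, ih, gaussWeight]
    push_cast
    field_simp
    ring

theorem hasSum_gaussWeight {x : ℝ} (hx : 0 ≤ x) : HasSum (fun a => gaussWeight a x) 1 := by
  rw [hasSum_iff_tendsto_nat_of_nonneg (fun a => gaussWeight_nonneg a hx)]
  simp_rw [sum_gaussWeight _ hx, add_assoc]
  exact tendsto_natCast_div_add_atTop (1 + x)

theorem gaussBranch_mem (a : ℕ) {x : ℝ} (hx : 0 ≤ x) : gaussBranch a x ∈ Set.Ioc (0 : ℝ) 1 := by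
  unfold gaussBranch
  refine ⟨by positivity, ?_⟩
  rw [div_le_one (by positivity)]
  have : (0 : ℝ) ≤ a := by positivity
  linarith

theorem summable_gaussTransfer {h : ℝ → ℝ} {c d : ℝ} (hb : ∀ x ∈ Set.Ioc (0 : ℝ) 1, h x ∈ Set.Icc c d)
    {x : ℝ} (hx : 0 ≤ x) : Summable (fun a => gaussWeight a x * h (gaussBranch a x)) := by
  refine Summable.of_norm_bounded ((hasSum_gaussWeight hx).summable.mul_right (max |c| |d|)) ?_
  intro a
  have h1 := hb _ (gaussBranch_mem a hx)
  rw [norm_mul, Real.norm_eq_abs, abs_of_nonneg (gaussWeight_nonneg a hx)]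
  exact mul_le_mul_of_nonneg_left (abs_le_max_abs_abs h1.1 h1.2) (gaussWeight_nonneg a hx)

theorem gaussTransfer_sub_const {h : ℝ → ℝ} {c d : ℝ}
    (hb : ∀ x ∈ Set.Ioc (0 : ℝ) 1, h x ∈ Set.Icc c d) {x : ℝ} (hx : 0 ≤ x) (r : ℝ) :
    gaussTransfer (fun x => h x - r) x = gaussTransfer h x - r := by
  have hs := summable_gaussTransfer hb hx
  have hw := (hasSum_gaussWeight hx).mul_right r
  rw [one_mul] at hw
  unfold gaussTransfer
  simp_rw [mul_sub]
  rw [hs.tsum_sub hw.summable, hw.tsum_eq]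

theorem gaussTransfer_neg (h : ℝ → ℝ) : gaussTransfer (fun x => -h x) = -gaussTransfer h := by
  ext x
  simp [gaussTransfer, tsum_neg]

/-- Stochastic monotonicity of the Gauss weights, in a form amenable to induction. -/
theorem sum_gaussWeight_mul_le {g : ℕ → ℝ} (hg : Antitone g) {x y : ℝ} (hx : 0 ≤ x) (hxy : x ≤ y)
    (n : ℕ) :
    ((n + 1) / (n + 2 + x) - (n + 1) / (n + 2 + y)) * g n ≤
      ∑ a ∈ Finset.range (n + 1), (gaussWeight a x - gaussWeight a y) * g a := by
  have hw : ∀ (n : ℕ) {x : ℝ}, 0 ≤ x →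
      ∑ a ∈ Finset.range (n + 1), gaussWeight a x = (n + 1) / (n + 2 + x) := by
    intro n x hx
    rw [sum_gaussWeight _ hx]
    push_cast
    ring
  have hy := hx.trans hxy
  induction n with
  | zero =>
    rw [← hw 0 hx, ← hw 0 hy]
    simp
  | succ n ih =>
    rw [Finset.sum_range_succ, ← hw _ hx, ← hw _ hy, Finset.sum_range_succ _ (n + 1),
      Finset.sum_range_succ _ (n + 1), hw _ hx, hw _ hy]
    have h1 : (n + 1) / (n + 2 + y) ≤ ((n : ℝ) + 1) / (n + 2 + x) := by gcongr
    have h2 := mul_le_mul_of_nonneg_left (hg (Nat.le_succ n)) (sub_nonneg.2 h1)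
    simp only [Nat.succ_eq_add_one] at h2
    linarith

theorem gaussTransfer_antitoneOn {h : ℝ → ℝ} {c d : ℝ}
    (hb : ∀ x ∈ Set.Ioc (0 : ℝ) 1, h x ∈ Set.Icc c d) (hm : MonotoneOn h (Set.Ioc 0 1)) :
    AntitoneOn (gaussTransfer h) (Set.Ici 0) := by
  wlog hc : c = 0 generalizing h c d
  · have := this (h := fun x => h x - c) (c := 0) (d := d - c)
      (fun x hx => ⟨sub_nonneg.2 (hb x hx).1, sub_le_sub_right (hb x hx).2 c⟩)
      (fun x hx y hy hxy => sub_le_sub_right (hm hx hy hxy) c) rfl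
    intro x hx y hy hxy
    have h2 := this hx hy hxy
    rw [gaussTransfer_sub_const hb hx, gaussTransfer_sub_const hb hy] at h2
    linarith
  subst hc
  intro x (hx : 0 ≤ x) y (hy : 0 ≤ y) hxy
  have hanti : Antitone (fun a : ℕ => h (gaussBranch a y)) := by
    intro a b hab
    refine hm (gaussBranch_mem b hy) (gaussBranch_mem a hy) ?_
    unfold gaussBranch
    gcongr
  refine le_of_tendsto_of_tendsto'
    ((tendsto_add_atTop_iff_nat 1).2 (summable_gaussTransfer hb hy).hasSum.tendsto_sum_nat)
    ((tendsto_add_atTop_iff_nat 1).2 (summable_gaussTransfer hb hx).hasSum.tendsto_sum_nat) ?_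
  intro n
  calc ∑ a ∈ Finset.range (n + 1), gaussWeight a y * h (gaussBranch a y)
      ≤ ∑ a ∈ Finset.range (n + 1), gaussWeight a x * h (gaussBranch a y) := by
        have h1 := sum_gaussWeight_mul_le hanti hx hxy n
        have h2 : (n + 1) / (n + 2 + y) ≤ ((n : ℝ) + 1) / (n + 2 + x) := by gcongr
        have h3 := mul_nonneg (sub_nonneg.2 h2) (hb _ (gaussBranch_mem n hy)).1
        simp_rw [sub_mul] at h1
        rw [Finset.sum_sub_distrib] at h1
        linarith
    _ ≤ _ := by
        refine Finset.sum_le_sum fun a _ => mul_le_mul_of_nonneg_left ?_ (gaussWeight_nonneg a hx)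
        refine hm (gaussBranch_mem a hy) (gaussBranch_mem a hx) ?_
        unfold gaussBranch
        gcongr

theorem gaussTransfer_zero_sub_one {h : ℝ → ℝ} {c d : ℝ}
    (hb : ∀ x ∈ Set.Ioc (0 : ℝ) 1, h x ∈ Set.Icc c d) :
    gaussTransfer h 0 - gaussTransfer h 1 ≤ (d - c) / 2 := by
  wlog hc : c = 0 generalizing h c d
  · have := this (h := fun x => h x - c) (c := 0) (d := d - c)
      (fun x hx => ⟨sub_nonneg.2 (hb x hx).1, sub_le_sub_right (hb x hx).2 c⟩) rfl
    rw [gaussTransfer_sub_const hb le_rfl, gaussTransfer_sub_const hb zero_le_one] at this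
    linarith
  subst hc
  have hs := summable_gaussTransfer hb le_rfl
  have h1 := hs.tsum_eq_zero_add
  have h2 : ∑' a, gaussWeight (a + 1) 0 * h (gaussBranch (a + 1) 0) ≤ gaussTransfer h 1 := by
    refine ((summable_nat_add_iff 1).2 hs).tsum_le_tsum ?_
      (summable_gaussTransfer hb zero_le_one)
    intro a
    have e : gaussBranch (a + 1) 0 = gaussBranch a 1 := by
      unfold gaussBranch; push_cast; ring_nf
    rw [e]
    refine mul_le_mul_of_nonneg_right ?_ (hb _ (gaussBranch_mem a zero_le_one)).1
    unfold gaussWeight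
    push_cast
    rw [div_le_div_iff₀ (by positivity) (by positivity)]
    have : (0 : ℝ) ≤ a := by positivity
    nlinarith [mul_nonneg this this]
  have h3 : gaussWeight 0 0 * h (gaussBranch 0 0) ≤ d / 2 := by
    have := (hb 1 (by simp)).2
    simp only [gaussWeight, gaussBranch]
    norm_num
    linarith
  rw [gaussTransfer, h1]
  linarith

/-- Nonnegative measurable functions, monotone on `(0, 1]` with oscillation at most `d`. -/
structure MonotoneOsc (h : ℝ → ℝ) (d : ℝ) : Prop where
  measurable : Measurable h
  nonneg : ∀ x ∈ Set.Ioc (0 : ℝ) 1, 0 ≤ h x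
  mono : MonotoneOn h (Set.Ioc 0 1) ∨ AntitoneOn h (Set.Ioc 0 1)
  osc : ∃ c, ∀ x ∈ Set.Ioc (0 : ℝ) 1, h x ∈ Set.Icc c (c + d)

theorem measurable_gaussTransfer {h : ℝ → ℝ} (hh : Measurable h) :
    Measurable (gaussTransfer h) := by
  unfold gaussTransfer
  refine Measurable.tsum fun a => ?_
  unfold gaussWeight gaussBranch
  fun_prop

theorem MonotoneOsc.gaussTransfer {h : ℝ → ℝ} {d : ℝ} (hh : MonotoneOsc h d) :
    MonotoneOsc (gaussTransfer h) (d / 2) := by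
  obtain ⟨hmeas, h0, hm, c, hc⟩ := hh
  have hsub : Set.Ioc (0 : ℝ) 1 ⊆ Set.Ici 0 := fun x hx => hx.1.le
  refine ⟨measurable_gaussTransfer hmeas, fun x hx => ?_, ?_, ?_⟩
  · exact tsum_nonneg fun a => mul_nonneg (gaussWeight_nonneg a hx.1.le)
      (h0 _ (gaussBranch_mem a hx.1.le))
  · rcases hm with hm | hm
    · exact Or.inr ((gaussTransfer_antitoneOn hc hm).mono hsub)
    · left
      have := gaussTransfer_antitoneOn (h := fun x => -h x) (c := -(c + d)) (d := -c)
        (fun x hx => ⟨neg_le_neg (hc x hx).2, neg_le_neg (hc x hx).1⟩) hm.neg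
      rw [gaussTransfer_neg] at this
      intro x hx y hy hxy
      exact neg_le_neg_iff.1 (this (hsub hx) (hsub hy) hxy)
  · rcases hm with hm | hm
    · have ha := gaussTransfer_antitoneOn hc hm
      refine ⟨_root_.gaussTransfer h 1, fun x hx => ⟨ha (Set.mem_Ici.2 hx.1.le) (Set.mem_Ici.2 zero_le_one) hx.2, ?_⟩⟩
      have := ha (Set.mem_Ici.2 le_rfl) (Set.mem_Ici.2 hx.1.le) hx.1.le
      have := gaussTransfer_zero_sub_one hc
      linarith
    · have hc' : ∀ x ∈ Set.Ioc (0 : ℝ) 1, -h x ∈ Set.Icc (-(c + d)) (-c) :=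
        fun x hx => ⟨neg_le_neg (hc x hx).2, neg_le_neg (hc x hx).1⟩
      have ha := gaussTransfer_antitoneOn hc' hm.neg
      have h1 := gaussTransfer_zero_sub_one hc'
      rw [gaussTransfer_neg] at ha h1
      refine ⟨_root_.gaussTransfer h 0, fun x hx => ?_⟩
      have h2 := ha (Set.mem_Ici.2 le_rfl) (Set.mem_Ici.2 hx.1.le) hx.1.le
      have h3 := ha (Set.mem_Ici.2 hx.1.le) (Set.mem_Ici.2 zero_le_one) hx.2
      simp only [Pi.neg_apply] at h1 h2 h3
      constructor <;> linarith

theorem MonotoneOsc.gaussTransfer_iterate {h : ℝ → ℝ} {d : ℝ} (hh : MonotoneOsc h d) (n : ℕ) :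
    MonotoneOsc (_root_.gaussTransfer^[n] h) (d / 2 ^ n) := by
  induction n with
  | zero => simpa using hh
  | succ n ih =>
    rw [Function.iterate_succ_apply', pow_succ, ← div_div]
    exact ih.gaussTransfer

/-- The Gauss measure on `(0, 1]`. -/
noncomputable def gaussMeasure : Measure ℝ :=
  (volume.restrict (Set.Ioc 0 1)).withDensity
    (fun x => ENNReal.ofReal (1 / ((1 + x) * Real.log 2)))

theorem lintegral_gaussMeasure {F : ℝ → ℝ≥0∞} (hF : Measurable F) :
    ∫⁻ x, F x ∂gaussMeasure =
      ∫⁻ x in Set.Ioc 0 1, ENNReal.ofReal (1 / ((1 + x) * Real.log 2)) * F x := by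
  rw [gaussMeasure, lintegral_withDensity_eq_lintegral_mul _ (by fun_prop) hF]
  rfl

theorem gaussMeasure_le {s : Set ℝ} (hs : MeasurableSet s) :
    gaussMeasure s ≤ ENNReal.ofReal (1 / Real.log 2) * volume (s ∩ Set.Ioc 0 1) := by
  have hlog : 0 < Real.log 2 := Real.log_pos one_lt_two
  rw [gaussMeasure, withDensity_apply _ hs, ← setLIntegral_const, Measure.restrict_restrict hs]
  refine setLIntegral_mono measurable_const fun x hx => ENNReal.ofReal_le_ofReal ?_
  have : 0 < x := hx.2.1
  apply one_div_le_one_div_of_le hlog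
  nlinarith

theorem le_gaussMeasure {s : Set ℝ} (hs : MeasurableSet s) :
    volume (s ∩ Set.Ioc 0 1) ≤ ENNReal.ofReal (2 * Real.log 2) * gaussMeasure s := by
  have hlog : 0 < Real.log 2 := Real.log_pos one_lt_two
  have h1 : ENNReal.ofReal (1 / (2 * Real.log 2)) * volume (s ∩ Set.Ioc 0 1) ≤ gaussMeasure s := by
    rw [gaussMeasure, withDensity_apply _ hs, ← setLIntegral_const, Measure.restrict_restrict hs]
    refine setLIntegral_mono (by fun_prop) fun x hx => ENNReal.ofReal_le_ofReal ?_
    have h0 : 0 < x := hx.2.1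
    apply one_div_le_one_div_of_le (by positivity)
    have := hx.2.2
    nlinarith
  calc volume (s ∩ Set.Ioc 0 1) = ENNReal.ofReal (2 * Real.log 2) *
        (ENNReal.ofReal (1 / (2 * Real.log 2)) * volume (s ∩ Set.Ioc 0 1)) := by
        rw [← mul_assoc, ← ENNReal.ofReal_mul (by positivity), mul_one_div_cancel (by positivity),
          ENNReal.ofReal_one, one_mul]
    _ ≤ _ := by gcongr

theorem ae_gaussMeasure_mem : ∀ᵐ x ∂gaussMeasure, x ∈ Set.Ioo (0 : ℝ) 1 := by
  refine (withDensity_absolutelyContinuous _ _).ae_le ?_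
  rw [← Measure.restrict_congr_set Ioo_ae_eq_Ioc]
  exact ae_restrict_mem measurableSet_Ioo

instance isProbabilityMeasure_gaussMeasure : IsProbabilityMeasure gaussMeasure := by
  constructor
  have hlog : 0 < Real.log 2 := Real.log_pos one_lt_two
  rw [gaussMeasure, withDensity_apply _ MeasurableSet.univ, Measure.restrict_univ]
  have hint : IntervalIntegrable (fun x : ℝ => 1 / ((1 + x) * Real.log 2)) volume 0 1 := by
    apply ContinuousOn.intervalIntegrable
    intro x hx
    rw [Set.uIcc_of_le zero_le_one] at hx
    have : (1 + x) * Real.log 2 ≠ 0 := by have := hx.1; positivity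
    fun_prop (disch := assumption)
  rw [← ofReal_integral_eq_lintegral_ofReal
    ((intervalIntegrable_iff_integrableOn_Ioc_of_le zero_le_one).1 hint), ←
    intervalIntegral.integral_of_le zero_le_one]
  · have : ∫ x in (0 : ℝ)..1, 1 / ((1 + x) * Real.log 2) = 1 := by
      simp_rw [← div_div]
      rw [intervalIntegral.integral_div, intervalIntegral.integral_comp_add_left (fun x => 1 / x),
        integral_one_div_of_pos (by norm_num) (by norm_num)]
      norm_num
    rw [this, ENNReal.ofReal_one]
  · filter_upwards [ae_restrict_mem measurableSet_Ioc] with x hx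
    have := hx.1
    simp only [Pi.zero_apply]
    positivity

theorem measurable_gaussMap : Measurable gaussMap := by
  unfold gaussMap
  fun_prop

theorem gaussMap_gaussBranch (a : ℕ) {x : ℝ} (hx : x ∈ Set.Ico (0 : ℝ) 1) :
    gaussMap (gaussBranch a x) = x := by
  have : (a : ℝ) + 1 + x = x + ((a + 1 : ℕ) : ℝ) := by push_cast; ring
  rw [gaussMap, gaussBranch, one_div_one_div, this, Int.fract_add_natCast,
    Int.fract_eq_self.2 ⟨hx.1, hx.2⟩]

theorem floor_gaussBranch (a : ℕ) {x : ℝ} (hx : x ∈ Set.Ico (0 : ℝ) 1) :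
    ⌊1 / gaussBranch a x⌋₊ = a + 1 := by
  rw [gaussBranch, one_div_one_div, Nat.floor_eq_iff (by have := hx.1; positivity)]
  push_cast
  exact ⟨by linarith [hx.1], by linarith [hx.2]⟩

theorem iUnion_gaussBranch_image :
    ⋃ a : ℕ, gaussBranch a '' Set.Ico (0 : ℝ) 1 = Set.Ioc 0 1 := by
  ext x
  simp only [Set.mem_iUnion, Set.mem_image]
  constructor
  · rintro ⟨a, t, ht, rfl⟩
    exact gaussBranch_mem a ht.1
  · intro hx
    have h1 : 1 ≤ 1 / x := by rw [le_div_iff₀ hx.1]; linarith [hx.2]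
    have h2 : 1 ≤ ⌊1 / x⌋₊ := Nat.one_le_floor_iff _ |>.2 h1
    refine ⟨⌊1 / x⌋₊ - 1, 1 / x - ⌊1 / x⌋₊, ⟨?_, ?_⟩, ?_⟩
    · linarith [Nat.floor_le (zero_le_one.trans h1)]
    · linarith [Nat.lt_floor_add_one (1 / x)]
    · rw [gaussBranch]
      push_cast [h2]
      simp

theorem lintegral_gaussBranch {F : ℝ → ℝ≥0∞} (hF : Measurable F) :
    ∫⁻ x, F x ∂gaussMeasure =
      ∫⁻ x, ∑' a, ENNReal.ofReal (gaussWeight a x) * F (gaussBranch a x) ∂gaussMeasure := by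
  have hlog : 0 < Real.log 2 := Real.log_pos one_lt_two
  have hbm : ∀ a, Measurable (gaussBranch a) := fun a => by unfold gaussBranch; fun_prop
  have hwm : ∀ a, Measurable (gaussWeight a) := fun a => by unfold gaussWeight; fun_prop
  have hinj : ∀ a, Set.InjOn (gaussBranch a) (Set.Ico 0 1) := fun a x hx y hy hxy => by
    rw [← gaussMap_gaussBranch a hx, hxy, gaussMap_gaussBranch a hy]
  have hmeas : ∀ a, MeasurableSet (gaussBranch a '' Set.Ico (0 : ℝ) 1) := fun a =>
    measurableSet_Ico.image_of_measurable_injOn (hbm a) (hinj a)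
  rw [lintegral_tsum (fun a => by fun_prop), lintegral_gaussMeasure hF,
    ← iUnion_gaussBranch_image, lintegral_iUnion hmeas]
  · refine tsum_congr fun a => ?_
    have hderiv : ∀ x ∈ Set.Ico (0 : ℝ) 1,
        HasDerivWithinAt (gaussBranch a) (-1 / (a + 1 + x) ^ 2) (Set.Ico 0 1) x := by
      intro x hx
      have hne : (a : ℝ) + 1 + x ≠ 0 := by have := hx.1; positivity
      have h := ((hasDerivAt_id x).const_add ((a : ℝ) + 1)).inv hne
      refine (h.congr_of_eventuallyEq ?_).hasDerivWithinAt
      filter_upwards with y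
      simp [gaussBranch]
    rw [lintegral_image_eq_lintegral_abs_deriv_mul measurableSet_Ico hderiv (hinj a),
      lintegral_gaussMeasure (by fun_prop), ← Measure.restrict_congr_set Ico_ae_eq_Ioc]
    refine setLIntegral_congr_fun measurableSet_Ico fun x hx => ?_
    have hx0 := hx.1
    rw [← mul_assoc, ← mul_assoc, ← ENNReal.ofReal_mul (abs_nonneg _),
      ← ENNReal.ofReal_mul (by positivity)]
    congr 2
    rw [neg_div, abs_neg, abs_of_nonneg (by positivity), gaussBranch, gaussWeight]
    field_simp
    ring
  · intro a b hab
    rw [Function.onFun, Set.disjoint_left]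
    rintro _ ⟨x, hx, rfl⟩ ⟨y, hy, hxy⟩
    have h1 := floor_gaussBranch a hx
    rw [← hxy, floor_gaussBranch b hy] at h1
    exact hab (by omega)

theorem MonotoneOsc.lintegral_mul_comp {h : ℝ → ℝ} {d : ℝ} (hh : MonotoneOsc h d) {g : ℝ → ℝ≥0∞}
    (hg : Measurable g) :
    ∫⁻ x, ENNReal.ofReal (h x) * g (gaussMap x) ∂gaussMeasure =
      ∫⁻ x, ENNReal.ofReal (_root_.gaussTransfer h x) * g x ∂gaussMeasure := by
  rw [lintegral_gaussBranch (F := fun x => ENNReal.ofReal (h x) * g (gaussMap x))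
    (hh.measurable.ennreal_ofReal.mul (hg.comp measurable_gaussMap))]
  refine lintegral_congr_ae ?_
  obtain ⟨c, hc⟩ := hh.osc
  filter_upwards [ae_gaussMeasure_mem] with x hx
  rw [_root_.gaussTransfer, ENNReal.ofReal_tsum_of_nonneg (fun a => mul_nonneg
    (gaussWeight_nonneg a hx.1.le) (hh.nonneg _ (gaussBranch_mem a hx.1.le)))
    (summable_gaussTransfer hc hx.1.le), ← ENNReal.tsum_mul_right]
  refine tsum_congr fun a => ?_
  rw [gaussMap_gaussBranch a ⟨hx.1.le, hx.2⟩, ENNReal.ofReal_mul (gaussWeight_nonneg a hx.1.le),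
    mul_assoc]

theorem measurePreserving_gaussMap : MeasurePreserving gaussMap gaussMeasure gaussMeasure := by
  refine ⟨measurable_gaussMap, Measure.ext fun s hs => ?_⟩
  have h : MonotoneOsc (fun _ => 1) 0 := ⟨measurable_const, fun _ _ => zero_le_one,
    Or.inl fun _ _ _ _ _ => le_rfl, 1, fun _ _ => by simp⟩
  rw [Measure.map_apply measurable_gaussMap hs, ← lintegral_indicator_one hs,
    ← lintegral_indicator_one (measurable_gaussMap hs)]
  have h1 := h.lintegral_mul_comp (g := s.indicator 1) (measurable_one.indicator hs)
  simp only [ENNReal.ofReal_one, one_mul] at h1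
  refine Eq.trans ?_ (h1.trans (lintegral_congr_ae ?_))
  · rfl
  · filter_upwards [ae_gaussMeasure_mem] with x hx
    have : gaussTransfer (fun _ => 1) x = 1 := by
      simp [gaussTransfer, (hasSum_gaussWeight hx.1.le).tsum_eq]
    rw [this, ENNReal.ofReal_one, one_mul]

theorem MonotoneOsc.lintegral_mul_comp_iterate (n : ℕ) : ∀ {h : ℝ → ℝ} {d : ℝ},
    MonotoneOsc h d → ∀ {g : ℝ → ℝ≥0∞}, Measurable g →
    ∫⁻ x, ENNReal.ofReal (h x) * g (gaussMap^[n] x) ∂gaussMeasure =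
      ∫⁻ x, ENNReal.ofReal (_root_.gaussTransfer^[n] h x) * g x ∂gaussMeasure := by
  induction n with
  | zero => intros; rfl
  | succ n ih =>
    intro h d hh g hg
    simp_rw [Function.iterate_succ_apply]
    rw [hh.lintegral_mul_comp (g := fun x => g (gaussMap^[n] x))
      (hg.comp (measurable_gaussMap.iterate n)), ih hh.gaussTransfer hg]

theorem MonotoneOsc.integrable {h : ℝ → ℝ} {d : ℝ} (hh : MonotoneOsc h d) :
    Integrable h gaussMeasure := by
  obtain ⟨c, hc⟩ := hh.osc
  refine Integrable.of_bound hh.measurable.aestronglyMeasurable (max |c| |c + d|) ?_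
  filter_upwards [ae_gaussMeasure_mem] with x hx
  have := hc x ⟨hx.1, hx.2.le⟩
  exact abs_le_max_abs_abs this.1 this.2

theorem MonotoneOsc.lintegral_mul_comp_iterate_le {h : ℝ → ℝ} {d : ℝ} (hh : MonotoneOsc h d)
    {g : ℝ → ℝ≥0∞} (hg : Measurable g) (n : ℕ) :
    ∫⁻ x, ENNReal.ofReal (h x) * g (gaussMap^[n] x) ∂gaussMeasure ≤
      ENNReal.ofReal (∫ x, h x ∂gaussMeasure + d / 2 ^ n) * ∫⁻ x, g x ∂gaussMeasure := by
  rw [hh.lintegral_mul_comp_iterate n hg, ← lintegral_const_mul _ hg]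
  refine lintegral_mono_ae ?_
  have hn := hh.gaussTransfer_iterate n
  obtain ⟨c, hc⟩ := hn.osc
  have h0 : ∀ {h : ℝ → ℝ} {d : ℝ}, MonotoneOsc h d → 0 ≤ᵐ[gaussMeasure] h := fun hh => by
    filter_upwards [ae_gaussMeasure_mem] with x hx using hh.nonneg x ⟨hx.1, hx.2.le⟩
  have hi : ∫ x, h x ∂gaussMeasure = ∫ x, _root_.gaussTransfer^[n] h x ∂gaussMeasure := by
    have := hh.lintegral_mul_comp_iterate n (g := fun _ => 1) measurable_const
    simp only [mul_one] at this
    rw [integral_eq_lintegral_of_nonneg_ae (h0 hh) hh.measurable.aestronglyMeasurable, this,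
      integral_eq_lintegral_of_nonneg_ae (h0 hn) hn.measurable.aestronglyMeasurable]
  have hcm : c ≤ ∫ x, h x ∂gaussMeasure := by
    rw [hi]
    have : ∫ _, c ∂gaussMeasure ≤ ∫ x, _root_.gaussTransfer^[n] h x ∂gaussMeasure := by
      refine integral_mono_ae (integrable_const c) hn.integrable ?_
      filter_upwards [ae_gaussMeasure_mem] with x hx using (hc x ⟨hx.1, hx.2.le⟩).1
    simpa using this
  filter_upwards [ae_gaussMeasure_mem] with x hx
  gcongr
  linarith [(hc x ⟨hx.1, hx.2.le⟩).2]

theorem MonotoneOsc.memLp {h : ℝ → ℝ} {d : ℝ} (hh : MonotoneOsc h d) (p : ℝ≥0∞) :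
    MemLp h p gaussMeasure := by
  obtain ⟨c, hc⟩ := hh.osc
  refine MemLp.of_bound hh.measurable.aestronglyMeasurable (max |c| |c + d|) ?_
  filter_upwards [ae_gaussMeasure_mem] with x hx
  have := hc x ⟨hx.1, hx.2.le⟩
  exact abs_le_max_abs_abs this.1 this.2

theorem MonotoneOsc.integral_mul_comp_iterate_le {h : ℝ → ℝ} {d : ℝ} (hh : MonotoneOsc h d)
    (hd : 0 ≤ d) (n : ℕ) :
    ∫ x, h x * h (gaussMap^[n] x) ∂gaussMeasure ≤
      (∫ x, h x ∂gaussMeasure + d / 2 ^ n) * ∫ x, h x ∂gaussMeasure := by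
  have h0 : 0 ≤ᵐ[gaussMeasure] h := by
    filter_upwards [ae_gaussMeasure_mem] with x hx using hh.nonneg x ⟨hx.1, hx.2.le⟩
  have hn : MeasurePreserving gaussMap^[n] gaussMeasure gaussMeasure :=
    measurePreserving_gaussMap.iterate n
  have hn0 : ∀ᵐ x ∂gaussMeasure, 0 ≤ h (gaussMap^[n] x) := hn.quasiMeasurePreserving.ae h0
  have hm := integral_nonneg_of_ae h0
  have hpn : (0 : ℝ) ≤ d / 2 ^ n := by positivity
  have := hh.lintegral_mul_comp_iterate_le hh.measurable.ennreal_ofReal n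
  rw [integral_eq_lintegral_of_nonneg_ae]
  · refine ENNReal.toReal_le_of_le_ofReal (mul_nonneg (by linarith) hm) ?_
    rw [ENNReal.ofReal_mul (by linarith), ofReal_integral_eq_lintegral_ofReal hh.integrable h0]
    refine (lintegral_congr_ae ?_).trans_le this
    filter_upwards [h0] with x hx using ENNReal.ofReal_mul hx
  · filter_upwards [h0, hn0] with x hx hx' using mul_nonneg hx hx'
  · exact (hh.measurable.mul (hh.measurable.comp hn.measurable)).aestronglyMeasurable

theorem MonotoneOsc.memLp_sum {h : ℝ → ℝ} {d : ℝ} (hh : MonotoneOsc h d) (s k : ℕ) :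
    MemLp (fun x => ∑ i ∈ Finset.range k, h (gaussMap^[s * i] x)) 2 gaussMeasure :=
  memLp_finsetSum _ fun i _ =>
    (hh.memLp 2).comp_measurePreserving (measurePreserving_gaussMap.iterate (s * i))

theorem MonotoneOsc.integral_sum {h : ℝ → ℝ} {d : ℝ} (hh : MonotoneOsc h d) (s k : ℕ) :
    ∫ x, ∑ i ∈ Finset.range k, h (gaussMap^[s * i] x) ∂gaussMeasure =
      k * ∫ x, h x ∂gaussMeasure := by
  have hmp := fun n => measurePreserving_gaussMap.iterate n
  rw [integral_finsetSum]
  · rw [Finset.sum_congr rfl (fun i _ => ?_), Finset.sum_const, Finset.card_range, nsmul_eq_mul]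
    rw [← (hmp (s * i)).map_eq, integral_map (hmp _).measurable.aemeasurable
      hh.measurable.aestronglyMeasurable, (hmp (s * i)).map_eq]
  · exact fun i _ => ((hh.memLp 1).comp_measurePreserving (hmp (s * i))).integrable le_rfl

theorem MonotoneOsc.integral_sum_sq_le {h : ℝ → ℝ} {d : ℝ} (hh : MonotoneOsc h d)
    (hd : ∀ x ∈ Set.Ioc (0 : ℝ) 1, h x ≤ d) {s : ℕ} (hs : 1 ≤ s) (k : ℕ) :
    ∫ x, (∑ i ∈ Finset.range k, h (gaussMap^[s * i] x)) ^ 2 ∂gaussMeasure ≤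
      (k * ∫ x, h x ∂gaussMeasure) ^ 2 + 3 * k * d * ∫ x, h x ∂gaussMeasure := by
  have hd0 : 0 ≤ d := (hh.nonneg 1 (by simp)).trans (hd 1 (by simp))
  have hmp := fun n => measurePreserving_gaussMap.iterate n
  have hLp : ∀ n, MemLp (fun x => h (gaussMap^[n] x)) 2 gaussMeasure :=
    fun n => (hh.memLp 2).comp_measurePreserving (hmp n)
  have hprod : ∀ n, Integrable (fun x => h x * h (gaussMap^[n] x)) gaussMeasure :=
    fun n => (hh.memLp 2).integrable_mul (hLp n)
  set m := ∫ x, h x ∂gaussMeasure with hm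
  have hm0 : 0 ≤ m := by
    refine integral_nonneg_of_ae ?_
    filter_upwards [ae_gaussMeasure_mem] with x hx using hh.nonneg x ⟨hx.1, hx.2.le⟩
  induction k with
  | zero => simp
  | succ k ih =>
    have hsplit : ∀ x, (∑ i ∈ Finset.range (k + 1), h (gaussMap^[s * i] x)) ^ 2 =
        h x ^ 2 + 2 * ∑ i ∈ Finset.range k, h x * h (gaussMap^[s * (i + 1)] x) +
          (∑ i ∈ Finset.range k, h (gaussMap^[s * i] (gaussMap^[s] x))) ^ 2 := by
      intro x
      rw [Finset.sum_range_succ', ← Finset.mul_sum]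
      simp_rw [← Function.iterate_add_apply, ← mul_add_one s]
      simp only [mul_zero, Function.iterate_zero, id_eq]
      ring
    have hsq : ∫ x, h x ^ 2 ∂gaussMeasure ≤ d * m := by
      rw [hm, ← integral_const_mul]
      refine integral_mono_ae (hh.memLp 2).integrable_sq (hh.integrable.const_mul d) ?_
      filter_upwards [ae_gaussMeasure_mem] with x hx
      have hx' : x ∈ Set.Ioc (0 : ℝ) 1 := ⟨hx.1, hx.2.le⟩
      nlinarith [hh.nonneg x hx', hd x hx']
    have hcross : ∑ i ∈ Finset.range k, ∫ x, h x * h (gaussMap^[s * (i + 1)] x) ∂gaussMeasure ≤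
        k * m ^ 2 + d * m := by
      calc _ ≤ ∑ i ∈ Finset.range k, (m ^ 2 + d * m * ((1 / 2) ^ i * (1 / 2))) := by
            refine Finset.sum_le_sum fun i _ =>
              (hh.integral_mul_comp_iterate_le hd0 _).trans ?_
            have : d / 2 ^ (s * (i + 1)) ≤ d / 2 ^ (i + 1) := by
              gcongr
              · norm_num
              · nlinarith
            rw [← pow_succ, one_div, inv_pow]
            rw [← hm]
            calc (m + d / 2 ^ (s * (i + 1))) * m ≤ (m + d / 2 ^ (i + 1)) * m := by gcongr
              _ = _ := by ring
        _ ≤ _ := by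
            have h2 : ∑ i ∈ Finset.range k, ((1 / 2 : ℝ) ^ i * (1 / 2)) ≤ 1 := by
              rw [← Finset.sum_mul]
              have := sum_geometric_two_le k
              linarith
            rw [Finset.sum_add_distrib, ← Finset.mul_sum, Finset.sum_const, Finset.card_range,
              nsmul_eq_mul]
            have := mul_le_mul_of_nonneg_left h2 (mul_nonneg hd0 hm0)
            linarith
    have hI : Integrable (fun x => (∑ i ∈ Finset.range k, h (gaussMap^[s * i] x)) ^ 2)
        gaussMeasure := (hh.memLp_sum s k).integrable_sq
    have hshift : ∫ x, (∑ i ∈ Finset.range k, h (gaussMap^[s * i] (gaussMap^[s] x))) ^ 2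
        ∂gaussMeasure = ∫ x, (∑ i ∈ Finset.range k, h (gaussMap^[s * i] x)) ^ 2 ∂gaussMeasure := by
      conv_rhs => rw [← (hmp s).map_eq]
      rw [integral_map (hmp s).measurable.aemeasurable]
      rw [(hmp s).map_eq]
      exact hI.aestronglyMeasurable
    have hcI : Integrable (fun x => ∑ i ∈ Finset.range k, h x * h (gaussMap^[s * (i + 1)] x))
        gaussMeasure := integrable_finsetSum _ fun i _ => hprod _
    have hI' : Integrable (fun x => (∑ i ∈ Finset.range k, h (gaussMap^[s * i] (gaussMap^[s] x))) ^ 2)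
        gaussMeasure := ((hh.memLp_sum s k).comp_measurePreserving (hmp s)).integrable_sq
    have hfst : Integrable (fun x => h x ^ 2 +
        2 * ∑ i ∈ Finset.range k, h x * h (gaussMap^[s * (i + 1)] x)) gaussMeasure :=
      (hh.memLp 2).integrable_sq.add (hcI.const_mul 2)
    simp_rw [hsplit]
    rw [integral_add hfst hI',
      integral_add (hh.memLp 2).integrable_sq (hcI.const_mul 2), integral_const_mul,
      integral_finsetSum _ (fun i _ => hprod _), hshift]
    push_cast
    nlinarith [sq_nonneg m]

theorem gaussMeasure_sum_deviation_le {f : ℝ → ℝ} (hf : Measurable f)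
    (hf0 : ∀ x ∈ Set.Ioc (0 : ℝ) 1, 0 ≤ f x) (hanti : AntitoneOn f (Set.Ioc 0 1)) {M : ℝ}
    (hM : 0 ≤ M) {s : ℕ} (hs : 1 ≤ s) (k : ℕ) {δ : ℝ} (hδ : 0 < δ) :
    gaussMeasure {x | δ ≤ |∑ i ∈ Finset.range k, f (gaussMap^[s * i] x) -
        k * ∫ x, min (f x) M ∂gaussMeasure|} ≤
      k * gaussMeasure {x | M < f x} +
        ENNReal.ofReal (3 * k * M * (∫ x, min (f x) M ∂gaussMeasure) / δ ^ 2) := by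
  have hmp := fun n => measurePreserving_gaussMap.iterate n
  have hh : MonotoneOsc (fun x => min (f x) M) M := by
    refine ⟨hf.min measurable_const, fun x hx => le_min (hf0 x hx) hM, Or.inr ?_, 0, ?_⟩
    · exact fun x hx y hy hxy => min_le_min_right _ (hanti hx hy hxy)
    · exact fun x hx => ⟨le_min (hf0 x hx) hM, by simp⟩
  have hsub : {x | δ ≤ |∑ i ∈ Finset.range k, f (gaussMap^[s * i] x) -
        k * ∫ x, min (f x) M ∂gaussMeasure|} ⊆
      (⋃ i ∈ Finset.range k, gaussMap^[s * i] ⁻¹' {x | M < f x}) ∪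
      {x | δ ≤ |∑ i ∈ Finset.range k, min (f (gaussMap^[s * i] x)) M -
        ∫ x, ∑ i ∈ Finset.range k, min (f (gaussMap^[s * i] x)) M ∂gaussMeasure|} := by
    intro x hx
    by_cases hbig : ∃ i ∈ Finset.range k, M < f (gaussMap^[s * i] x)
    · obtain ⟨i, hi, hfi⟩ := hbig
      exact Or.inl (Set.mem_biUnion hi hfi)
    · right
      push Not at hbig
      simp only [Set.mem_ofPred_eq] at hx ⊢
      rw [hh.integral_sum s k, Finset.sum_congr rfl (fun i hi => min_eq_left (hbig i hi))]
      exact hx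
  refine (measure_mono hsub).trans ((measure_union_le _ _).trans (add_le_add ?_ ?_))
  · refine (measure_biUnion_finset_le _ _).trans ?_
    rw [Finset.sum_congr rfl (fun i _ => (hmp (s * i)).measure_preimage
      (measurableSet_lt measurable_const hf).nullMeasurableSet)]
    simp
  · refine (ProbabilityTheory.meas_ge_le_variance_div_sq (hh.memLp_sum s k) hδ).trans
      (ENNReal.ofReal_le_ofReal ?_)
    gcongr
    rw [ProbabilityTheory.variance_eq_sub (hh.memLp_sum s k), hh.integral_sum s k]
    have := hh.integral_sum_sq_le (fun x _ => min_le_right _ _) hs k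
    simp only [Pi.pow_apply]
    linarith

theorem integral_gaussMeasure (f : ℝ → ℝ) :
    ∫ x, f x ∂gaussMeasure =
      (∫ x in (0 : ℝ)..1, f x / (1 + x)) / Real.log 2 := by
  have hlog : 0 < Real.log 2 := Real.log_pos one_lt_two
  rw [gaussMeasure, integral_withDensity_eq_integral_toReal_smul (by fun_prop)
    (ae_of_all _ fun _ => ENNReal.ofReal_lt_top), ← intervalIntegral.integral_div,
    intervalIntegral.integral_of_le zero_le_one]
  refine setIntegral_congr_fun measurableSet_Ioc fun x hx => ?_
  have := hx.1
  simp only [smul_eq_mul]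
  rw [ENNReal.toReal_ofReal (by positivity)]
  field_simp

theorem integral_pow_mul_neg_log (n : ℕ) :
    ∫ x in (0 : ℝ)..1, x ^ n * -Real.log x = 1 / ((n : ℝ) + 1) ^ 2 := by
  have hH : ∀ x ∈ Set.Ioo (0 : ℝ) 1, HasDerivAt
      (fun x : ℝ => x ^ (n + 1) / (n + 1) ^ 2 - x ^ n * (x * Real.log x) / (n + 1))
      (x ^ n * -Real.log x) x := by
    intro x hx
    have h1 : HasDerivAt (fun x : ℝ => x ^ (n + 1) / (n + 1) ^ 2 -
        x ^ (n + 1) * Real.log x / (n + 1)) _ x :=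
      ((hasDerivAt_pow (n + 1) x).div_const _).sub
        (((hasDerivAt_pow (n + 1) x).mul (Real.hasDerivAt_log hx.1.ne')).div_const _)
    convert! h1 using 1
    · ext y; ring
    · have := hx.1.ne'
      push_cast
      field_simp
      ring
  have hcont : Continuous
      (fun x : ℝ => x ^ (n + 1) / (n + 1) ^ 2 - x ^ n * (x * Real.log x) / (n + 1)) := by
    have := Real.continuous_mul_log
    fun_prop
  rw [intervalIntegral.integral_eq_sub_of_hasDerivAt_of_le zero_le_one hcont.continuousOn hH]
  · simp
  · exact intervalIntegral.intervalIntegrable_log'.neg.continuousOn_mul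
      (continuous_pow n).continuousOn

theorem hasSum_odd_sub_even_inv_sq :
    HasSum (fun n : ℕ => 1 / (((2 * n : ℕ) : ℝ) + 1) ^ 2 - 1 / (((2 * n + 1 : ℕ) : ℝ) + 1) ^ 2)
      (π ^ 2 / 12) := by
  have hz := hasSum_zeta_two
  have heven : HasSum (fun n : ℕ => (1 : ℝ) / ((2 * n : ℕ) : ℝ) ^ 2) (π ^ 2 / 24) := by
    convert! hz.mul_left (1 / 4) using 1
    · ext n
      push_cast
      rw [mul_pow, div_mul_div_comm]
      norm_num
    · ring
  have hodd : HasSum (fun n : ℕ => (1 : ℝ) / ((2 * n + 1 : ℕ) : ℝ) ^ 2) (π ^ 2 / 8) := by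
    have hs : Summable (fun n : ℕ => (1 : ℝ) / ((2 * n + 1 : ℕ) : ℝ) ^ 2) :=
      hz.summable.comp_injective (i := fun n : ℕ => 2 * n + 1) (fun a b h => by simpa using h)
    have := (heven.even_add_odd hs.hasSum (f := fun n : ℕ => (1 : ℝ) / (n : ℝ) ^ 2)).unique hz
    convert! hs.hasSum using 1
    linarith
  have heven' : HasSum (fun n : ℕ => (1 : ℝ) / ((2 * (n + 1) : ℕ) : ℝ) ^ 2) (π ^ 2 / 24) := by
    rw [hasSum_nat_add_iff (f := fun n : ℕ => (1 : ℝ) / ((2 * n : ℕ) : ℝ) ^ 2) 1]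
    simpa using heven
  convert! hodd.sub heven' using 1
  · ext n
    push_cast
    ring_nf
  · ring

theorem integral_neg_log_div : ∫ x in (0 : ℝ)..1, -Real.log x / (1 + x) = π ^ 2 / 12 := by
  have hint : ∀ n : ℕ, IntervalIntegrable (fun x : ℝ => x ^ n * -Real.log x) volume 0 1 :=
    fun n => intervalIntegral.intervalIntegrable_log'.neg.continuousOn_mul
      (continuous_pow n).continuousOn
  have hI : ∀ n : ℕ, ∫ x in (0 : ℝ)..1,
      (x ^ (2 * n) * -Real.log x - x ^ (2 * n + 1) * -Real.log x) =
      1 / (((2 * n : ℕ) : ℝ) + 1) ^ 2 - 1 / (((2 * n + 1 : ℕ) : ℝ) + 1) ^ 2 := fun n => by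
    rw [intervalIntegral.integral_sub (hint _) (hint _), integral_pow_mul_neg_log,
      integral_pow_mul_neg_log]
  have hIoc : ∀ n : ℕ, IntegrableOn (fun x : ℝ =>
      x ^ (2 * n) * -Real.log x - x ^ (2 * n + 1) * -Real.log x) (Set.Ioc 0 1) := fun n =>
    (intervalIntegrable_iff_integrableOn_Ioc_of_le zero_le_one).1 ((hint _).sub (hint _))
  simp_rw [intervalIntegral.integral_of_le (zero_le_one (α := ℝ))] at hI ⊢
  have hnorm : ∀ n : ℕ, ∫ x in Set.Ioc (0 : ℝ) 1,
      ‖x ^ (2 * n) * -Real.log x - x ^ (2 * n + 1) * -Real.log x‖ =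
      1 / (((2 * n : ℕ) : ℝ) + 1) ^ 2 - 1 / (((2 * n + 1 : ℕ) : ℝ) + 1) ^ 2 := fun n => by
    rw [← hI n]
    refine setIntegral_congr_fun measurableSet_Ioc fun x hx => ?_
    rw [Real.norm_of_nonneg]
    have h1 := Real.log_nonpos hx.1.le hx.2
    have h2 : 0 ≤ x ^ (2 * n) * ((1 - x) * -Real.log x) :=
      mul_nonneg (pow_nonneg hx.1.le _) (mul_nonneg (sub_nonneg.2 hx.2) (by linarith))
    calc _ ≤ _ := h2
      _ = _ := by ring
  have key := hasSum_integral_of_summable_integral_norm (μ := volume.restrict (Set.Ioc (0 : ℝ) 1))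
    (F := fun (n : ℕ) (x : ℝ) => x ^ (2 * n) * -Real.log x - x ^ (2 * n + 1) * -Real.log x)
    hIoc (by simp_rw [hnorm]; exact hasSum_odd_sub_even_inv_sq.summable)
  simp_rw [hI] at key
  rw [← key.unique hasSum_odd_sub_even_inv_sq, ← Measure.restrict_congr_set Ioo_ae_eq_Ioc]
  refine setIntegral_congr_fun measurableSet_Ioo fun x hx => ?_
  have hx2 : x ^ 2 < 1 := by nlinarith [hx.1, hx.2]
  have hg := (hasSum_geometric_of_lt_one (sq_nonneg x) hx2).mul_right ((1 - x) * -Real.log x)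
  have e : ∀ n : ℕ, x ^ (2 * n) * -Real.log x - x ^ (2 * n + 1) * -Real.log x =
      (x ^ 2) ^ n * ((1 - x) * -Real.log x) := fun n => by ring
  simp only [e]
  rw [hg.tsum_eq]
  have h1 : 1 - x ^ 2 = (1 - x) * (1 + x) := by ring
  have h2 : 1 - x ≠ 0 := by linarith [hx.2]
  have h3 : 1 + x ≠ 0 := by linarith [hx.1]
  rw [h1]
  field_simp

theorem integrable_log_gaussMeasure : Integrable (fun x => -Real.log x) gaussMeasure := by
  have h : IntegrableOn (fun x => -Real.log x) (Set.Ioc 0 1) :=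
    (intervalIntegrable_iff_integrableOn_Ioc_of_le zero_le_one).1
      intervalIntegral.intervalIntegrable_log'.neg
  have hle : gaussMeasure ≤ ENNReal.ofReal (1 / Real.log 2) • volume.restrict (Set.Ioc 0 1) := by
    refine Measure.le_iff.2 fun s hs => (gaussMeasure_le hs).trans_eq ?_
    rw [Measure.smul_apply, Measure.restrict_apply hs, smul_eq_mul]
  exact (h.smul_measure ENNReal.ofReal_ne_top).mono_measure hle

theorem tendsto_integral_min_neg_log {M : ℕ → ℝ} (hM : Tendsto M atTop atTop) :
    Tendsto (fun k => ∫ x, min (-Real.log x) (M k) ∂gaussMeasure) atTop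
      (nhds (π ^ 2 / 12 / Real.log 2)) := by
  rw [← integral_neg_log_div, ← integral_gaussMeasure (fun x => -Real.log x)]
  refine tendsto_integral_filter_of_dominated_convergence (fun x => |Real.log x|)
    (Eventually.of_forall fun k => by
      exact (Real.measurable_log.neg.min measurable_const).aestronglyMeasurable) ?_
    (by simpa using integrable_log_gaussMeasure.abs) ?_
  · filter_upwards [hM.eventually_ge_atTop 0] with k hk
    filter_upwards [ae_gaussMeasure_mem] with x hx
    have h1 := Real.log_neg hx.1 hx.2
    rw [Real.norm_eq_abs, abs_of_neg h1, abs_of_nonneg (le_min (by linarith) hk)]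
    exact min_le_left _ _
  · refine ae_of_all _ fun x => tendsto_const_nhds.congr' ?_
    filter_upwards [hM.eventually_ge_atTop (-Real.log x)] with k hk
    rw [min_eq_left hk]

theorem abs_integral_min_inv_sub_log_le {M : ℝ} (hM : 1 ≤ M) :
    |Real.log 2 * ∫ x, min (1 / x) M ∂gaussMeasure - Real.log M| ≤ 1 := by
  have hlog : 0 < Real.log 2 := Real.log_pos one_lt_two
  have hM0 : 0 < M := by linarith
  have hMi : 1 / M ≤ 1 := by rw [div_le_one hM0]; exact hM
  have hMp : 0 < 1 / M := by positivity
  rw [integral_gaussMeasure, mul_div_cancel₀ _ hlog.ne']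
  have hmeas : Measurable fun x : ℝ => min (1 / x) M / (1 + x) := by fun_prop
  have hbd : ∀ x ∈ Set.Ioc (0 : ℝ) 1, 0 ≤ min (1 / x) M / (1 + x) ∧
      min (1 / x) M / (1 + x) ≤ min (1 / x) M := by
    intro x hx
    have hx0 := hx.1
    have h0 : 0 ≤ min (1 / x) M := le_min (by positivity) hM0.le
    exact ⟨by positivity, div_le_self h0 (by linarith)⟩
  have hint : ∀ a b : ℝ, 0 ≤ a → a ≤ b → b ≤ 1 →
      IntervalIntegrable (fun x : ℝ => min (1 / x) M / (1 + x)) volume a b := by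
    intro a b ha hab hb
    rw [intervalIntegrable_iff_integrableOn_Ioc_of_le hab]
    refine Measure.integrableOn_of_bounded (M := M) (by simp) hmeas.aestronglyMeasurable ?_
    filter_upwards [ae_restrict_mem measurableSet_Ioc] with x hx
    have hx' : x ∈ Set.Ioc (0 : ℝ) 1 := ⟨ha.trans_lt hx.1, hx.2.trans hb⟩
    rw [Real.norm_of_nonneg (hbd x hx').1]
    exact (hbd x hx').2.trans (min_le_right _ _)
  have hinv : IntervalIntegrable (fun x : ℝ => 1 / x) volume (1 / M) 1 := by
    apply ContinuousOn.intervalIntegrable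
    intro x hx
    rw [Set.uIcc_of_le hMi] at hx
    have : x ≠ 0 := (hMp.trans_le hx.1).ne'
    fun_prop (disch := assumption)
  have hloginv : ∫ x in (1 / M)..1, 1 / x = Real.log M := by
    rw [integral_one_div_of_pos hMp one_pos, one_div_one_div]
  rw [← intervalIntegral.integral_add_adjacent_intervals (hint 0 (1 / M) le_rfl hMp.le hMi)
    (hint (1 / M) 1 hMp.le hMi le_rfl)]
  have h1 : 0 ≤ ∫ x in (0 : ℝ)..(1 / M), min (1 / x) M / (1 + x) := by
    rw [intervalIntegral.integral_of_le hMp.le]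
    exact setIntegral_nonneg measurableSet_Ioc fun x hx => (hbd x ⟨hx.1, hx.2.trans hMi⟩).1
  have h2 : ∫ x in (0 : ℝ)..(1 / M), min (1 / x) M / (1 + x) ≤ 1 := by
    have : ∫ _ in (0 : ℝ)..(1 / M), M = 1 := by
      rw [intervalIntegral.integral_const, smul_eq_mul, sub_zero, one_div_mul_cancel hM0.ne']
    refine le_of_le_of_eq ?_ this
    refine intervalIntegral.integral_mono_on_of_le_Ioo hMp.le (hint 0 (1 / M) le_rfl hMp.le hMi)
      intervalIntegrable_const fun x hx =>
        (hbd x ⟨hx.1, hx.2.le.trans hMi⟩).2.trans (min_le_right _ _)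
  have h3 : ∫ x in (1 / M)..1, min (1 / x) M / (1 + x) ≤ Real.log M := by
    rw [← hloginv]
    exact intervalIntegral.integral_mono_on hMi (hint _ _ hMp.le hMi le_rfl) hinv fun x hx =>
      (hbd x ⟨hMp.trans_le hx.1, hx.2⟩).2.trans (min_le_left _ _)
  have h4 : Real.log M - 1 ≤ ∫ x in (1 / M)..1, min (1 / x) M / (1 + x) := by
    have e : ∫ x in (1 / M)..1, (1 / x - 1) = Real.log M - (1 - 1 / M) := by
      rw [intervalIntegral.integral_sub hinv intervalIntegrable_const, hloginv]
      simp
    have : ∫ x in (1 / M)..1, (1 / x - 1) ≤ ∫ x in (1 / M)..1, min (1 / x) M / (1 + x) := by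
      refine intervalIntegral.integral_mono_on hMi (hinv.sub intervalIntegrable_const)
        (hint _ _ hMp.le hMi le_rfl) fun x hx => ?_
      have hx0 : 0 < x := hMp.trans_le hx.1
      have : 1 / x ≤ M := by
        rw [div_le_iff₀ hx0]
        have := hx.1
        rw [div_le_iff₀ hM0] at this
        linarith
      rw [min_eq_left this, le_div_iff₀ (by linarith)]
      have : 1 / x * x = 1 := one_div_mul_cancel hx0.ne'
      nlinarith
    linarith
  rw [abs_le]
  constructor <;> linarith

theorem tendsto_gaussMeasure_sum_div {f : ℝ → ℝ} (hf : Measurable f)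
    (hf0 : ∀ x ∈ Set.Ioc (0 : ℝ) 1, 0 ≤ f x) (hanti : AntitoneOn f (Set.Ioc 0 1))
    {M b c : ℕ → ℝ} {l : ℝ} (hM : ∀ k, 0 ≤ M k) {s : ℕ} (hs : 1 ≤ s)
    (hc : ∀ᶠ k in atTop, 0 < c k) (hb : Tendsto b atTop (nhds 0))
    (htail : ∀ᶠ k : ℕ in atTop, k * gaussMeasure {x | M k < f x} ≤ ENNReal.ofReal (b k))
    (hvar : Tendsto (fun k : ℕ => k * M k * (∫ x, min (f x) (M k) ∂gaussMeasure) / c k ^ 2) atTop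
      (nhds 0))
    (hmean : Tendsto (fun k : ℕ => k * (∫ x, min (f x) (M k) ∂gaussMeasure) / c k) atTop (nhds l))
    {η : ℝ} (hη : 0 < η) :
    Tendsto (fun k : ℕ => gaussMeasure
      {x | η ≤ |(∑ i ∈ Finset.range k, f (gaussMap^[s * i] x)) / c k - l|}) atTop (nhds 0) := by
  have hlim : Tendsto (fun k : ℕ => ENNReal.ofReal (b k) + ENNReal.ofReal
      (12 / η ^ 2 * (k * M k * (∫ x, min (f x) (M k) ∂gaussMeasure) / c k ^ 2)))
      atTop (nhds 0) := by
    have h1 := ENNReal.tendsto_ofReal hb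
    have h2 := ENNReal.tendsto_ofReal (hvar.const_mul (12 / η ^ 2))
    simpa using h1.add h2
  refine tendsto_of_tendsto_of_tendsto_of_le_of_le' tendsto_const_nhds hlim
    (Eventually.of_forall fun _ => zero_le) ?_
  filter_upwards [hc, htail, Metric.tendsto_nhds.1 hmean (η / 2) (by positivity)] with k hck htk hmk
  refine le_trans (measure_mono ?_) ((gaussMeasure_sum_deviation_le hf hf0 hanti (hM k) hs k
    (δ := η / 2 * c k) (by positivity)).trans (add_le_add htk (le_of_eq ?_)))
  · intro x hx
    simp only [Set.mem_ofPred_eq] at hx ⊢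
    rw [Real.dist_eq] at hmk
    set S := ∑ i ∈ Finset.range k, f (gaussMap^[s * i] x)
    set m := ∫ x, min (f x) (M k) ∂gaussMeasure
    have h1 := abs_sub_le (S / c k) (k * m / c k) l
    have h2 : η / 2 ≤ |S / c k - k * m / c k| := by linarith
    rwa [← sub_div, abs_div, abs_of_pos hck, le_div_iff₀ hck] at h2
  · congr 1
    field_simp
    ring

theorem tendsto_gaussMeasure_neg_log_sum {η : ℝ} (hη : 0 < η) :
    Tendsto (fun k : ℕ => gaussMeasure
      {x | η ≤ |(∑ j ∈ Finset.range k, -Real.log (gaussMap^[j] x)) / k -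
        π ^ 2 / 12 / Real.log 2|}) atTop (nhds 0) := by
  have hlog : 0 < Real.log 2 := Real.log_pos one_lt_two
  have hsqrt : Tendsto (fun k : ℕ => √(k : ℝ)) atTop atTop :=
    Real.tendsto_sqrt_atTop.comp tendsto_natCast_atTop_atTop
  have hmean := tendsto_integral_min_neg_log hsqrt
  have hpos : ∀ᶠ k : ℕ in atTop, (0 : ℝ) < k := by
    filter_upwards [eventually_gt_atTop 0] with k hk
    exact_mod_cast hk
  have := tendsto_gaussMeasure_sum_div (f := fun x => -Real.log x) (M := fun k => √(k : ℝ))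
    (b := fun k => 1 / Real.log 2 * (√(k : ℝ) ^ 2 * Real.exp (-√(k : ℝ)))) (c := fun k => (k : ℝ))
    (l := π ^ 2 / 12 / Real.log 2) (s := 1) Real.measurable_log.neg
    (fun x hx => by have := Real.log_nonpos hx.1.le hx.2; linarith)
    (fun x hx y hy hxy => neg_le_neg (Real.log_le_log hx.1 hxy)) (fun k => Real.sqrt_nonneg _)
    le_rfl hpos ?_ ?_ ?_ ?_ hη
  · simpa using this
  · have := ((Real.tendsto_pow_mul_exp_neg_atTop_nhds_zero 2).comp hsqrt).const_mul
      (1 / Real.log 2)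
    simpa using this
  · refine Eventually.of_forall fun k => ?_
    have hsub : {x | √(k : ℝ) < -Real.log x} ∩ Set.Ioc 0 1 ⊆ Set.Ioc 0 (Real.exp (-√(k : ℝ))) := by
      rintro x ⟨hx, hx0, -⟩
      refine ⟨hx0, ?_⟩
      rw [← Real.log_le_iff_le_exp hx0]
      exact le_neg_of_le_neg (le_of_lt hx)
    calc (k : ℝ≥0∞) * gaussMeasure {x | √(k : ℝ) < -Real.log x}
        ≤ k * (ENNReal.ofReal (1 / Real.log 2) *
            volume (Set.Ioc 0 (Real.exp (-√(k : ℝ))))) := by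
          gcongr
          refine (gaussMeasure_le (measurableSet_lt measurable_const
            Real.measurable_log.neg)).trans ?_
          gcongr
          exact hsub
      _ = _ := by
          rw [Real.volume_Ioc, sub_zero, Real.sq_sqrt (Nat.cast_nonneg k),
            ENNReal.ofReal_mul (by positivity), ENNReal.ofReal_mul (by positivity),
            ENNReal.ofReal_natCast]
          ring
  · have h1 := hmean.mul (tendsto_inv_atTop_zero.comp hsqrt)
    rw [mul_zero] at h1
    refine h1.congr' ?_
    filter_upwards [hpos] with k hk
    have h2 : √(k : ℝ) * √(k : ℝ) = k := Real.mul_self_sqrt hk.le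
    have h3 : 0 < √(k : ℝ) := Real.sqrt_pos.2 hk
    simp only [Function.comp]
    rw [eq_div_iff (by positivity), show (k : ℝ) ^ 2 = k * (√(k : ℝ) * √(k : ℝ)) by rw [h2]; ring]
    field_simp
  · refine hmean.congr' ?_
    filter_upwards [hpos] with k hk
    rw [mul_div_cancel_left₀ _ hk.ne']

theorem tendsto_gaussMeasure_inv_sum {η : ℝ} (hη : 0 < η) :
    Tendsto (fun k : ℕ => gaussMeasure
      {x | η ≤ |(∑ i ∈ Finset.range k, 1 / gaussMap^[2 * i] x) / (k * Real.log k) -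
        1 / Real.log 2|}) atTop (nhds 0) := by
  have hlog : 0 < Real.log 2 := Real.log_pos one_lt_two
  have hL : Tendsto (fun k : ℕ => Real.log k) atTop atTop :=
    Real.tendsto_log_atTop.comp tendsto_natCast_atTop_atTop
  have hsL : Tendsto (fun k : ℕ => √(Real.log k)) atTop atTop :=
    Real.tendsto_sqrt_atTop.comp hL
  have hgood : ∀ᶠ k : ℕ in atTop, (1 : ℝ) ≤ k ∧ 1 ≤ Real.log k := by
    filter_upwards [eventually_ge_atTop 1, hL.eventually_ge_atTop 1] with k hk hk'
    exact ⟨by exact_mod_cast hk, hk'⟩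
  have hmean : Tendsto (fun k : ℕ =>
      (∫ x, min (1 / x) (k * √(Real.log k)) ∂gaussMeasure) / Real.log k) atTop
      (nhds (1 / Real.log 2)) := by
    have hloglog : Tendsto (fun k : ℕ => Real.log (Real.log k) / Real.log k) atTop (nhds 0) :=
      (Real.isLittleO_log_id_atTop.tendsto_div_nhds_zero).comp hL
    have hbound : Tendsto (fun k : ℕ => (1 / Real.log k +
        1 / 2 * (Real.log (Real.log k) / Real.log k)) / Real.log 2) atTop (nhds 0) := by
      have h1 := ((tendsto_inv_atTop_zero.comp hL).add (hloglog.const_mul (1 / 2))).div_const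
        (Real.log 2)
      simpa using h1
    rw [← tendsto_sub_nhds_zero_iff]
    refine squeeze_zero_norm' ?_ hbound
    filter_upwards [hgood] with k ⟨hk, hk'⟩
    have hM : 1 ≤ k * √(Real.log k) := by
      have : 1 ≤ √(Real.log k) := Real.one_le_sqrt.2 hk'
      nlinarith
    have h1 := abs_integral_min_inv_sub_log_le hM
    have hk0 : (0 : ℝ) < Real.log k := by linarith
    rw [Real.log_mul (by linarith) (Real.sqrt_pos.2 hk0).ne', Real.log_sqrt hk0.le] at h1
    set m := ∫ x, min (1 / x) (k * √(Real.log k)) ∂gaussMeasure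
    have hll : 0 ≤ Real.log (Real.log k) := Real.log_nonneg hk'
    have e : m / Real.log k - 1 / Real.log 2 =
        (Real.log 2 * m - Real.log k) / Real.log k / Real.log 2 := by field_simp
    rw [Real.norm_eq_abs, e, abs_div, abs_div, abs_of_pos hk0, abs_of_pos hlog]
    gcongr
    rw [← mul_div_assoc, ← add_div]
    gcongr
    rw [abs_le] at h1 ⊢
    constructor <;> linarith
  refine tendsto_gaussMeasure_sum_div (f := fun x => 1 / x) (M := fun k => k * √(Real.log k))
    (b := fun k => 1 / Real.log 2 * (√(Real.log k))⁻¹) (c := fun k => k * Real.log k)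
    (l := 1 / Real.log 2) (s := 2) (by fun_prop)
    (fun x hx => by have := hx.1; positivity)
    (fun x hx y hy hxy => one_div_le_one_div_of_le hx.1 hxy) (fun k => by positivity)
    one_le_two ?_ ?_ ?_ ?_ ?_ hη
  · filter_upwards [hgood] with k ⟨hk, hk'⟩
    nlinarith
  · simpa using (tendsto_inv_atTop_zero.comp hsL).const_mul (1 / Real.log 2)
  · filter_upwards [hgood] with k ⟨hk, hk'⟩
    have hs0 : 0 < √(Real.log k) := Real.sqrt_pos.2 (by linarith)
    have hM0 : 0 < k * √(Real.log k) := by nlinarith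
    have hsub : {x | k * √(Real.log k) < 1 / x} ∩ Set.Ioc 0 1 ⊆
        Set.Ioc 0 (1 / (k * √(Real.log k))) := by
      rintro x ⟨hx, hx0, -⟩
      exact ⟨hx0, ((lt_one_div hM0 hx0).1 hx).le⟩
    calc (k : ℝ≥0∞) * gaussMeasure {x | k * √(Real.log k) < 1 / x}
        ≤ k * (ENNReal.ofReal (1 / Real.log 2) *
            volume (Set.Ioc 0 (1 / (k * √(Real.log k))))) := by
          gcongr
          refine (gaussMeasure_le (measurableSet_lt measurable_const (by fun_prop))).trans ?_
          gcongr
      _ = ENNReal.ofReal (k * (1 / Real.log 2 * (1 / (k * √(Real.log k))))) := by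
          rw [Real.volume_Ioc, sub_zero, ENNReal.ofReal_mul (by positivity),
            ENNReal.ofReal_mul (by positivity), ENNReal.ofReal_natCast]
      _ = _ := by
          congr 1
          have : (k : ℝ) ≠ 0 := by linarith
          field_simp
  · have h1 := hmean.mul (tendsto_inv_atTop_zero.comp hsL)
    rw [mul_zero] at h1
    refine h1.congr' ?_
    filter_upwards [hgood] with k ⟨hk, hk'⟩
    have hk0 : (0 : ℝ) < Real.log k := by linarith
    have hs0 : 0 < √(Real.log k) := Real.sqrt_pos.2 hk0
    have h2 : √(Real.log k) * √(Real.log k) = Real.log k := Real.mul_self_sqrt hk0.le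
    have : (k : ℝ) ≠ 0 := by linarith
    simp only [Function.comp]
    rw [eq_div_iff (by positivity)]
    field_simp
    rw [pow_two, h2]
    ring
  · refine hmean.congr' ?_
    filter_upwards [hgood] with k ⟨hk, hk'⟩
    rw [mul_div_mul_left _ _ (by linarith)]

theorem volume_inter_le_gaussMeasure (s : Set ℝ) :
    volume (s ∩ Set.Ioc 0 1) ≤ ENNReal.ofReal (2 * Real.log 2) * gaussMeasure s := by
  rw [← measure_toMeasurable s]
  exact (measure_mono (Set.inter_subset_inter_left _ (subset_toMeasurable _ _))).trans
    (le_gaussMeasure (measurableSet_toMeasurable _ _))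

theorem excursionTime_bounds {x : ℝ} (hx : x ∈ Set.Ioo (0 : ℝ) 1) (hi : Irrational x) (k : ℕ) :
    ∑ i ∈ Finset.range k, 1 / gaussMap^[2 * i] x - k ≤ excursionTime k x ∧
    (excursionTime k x : ℝ) ≤ ∑ i ∈ Finset.range k, 1 / gaussMap^[2 * i] x := by
  rw [excursionTime, Nat.cast_sum]
  constructor
  · rw [sub_le_iff_le_add]
    calc _ ≤ ∑ i ∈ Finset.range k, ((⌊1 / gaussMap^[2 * i] x⌋₊ : ℝ) + 1) :=
          Finset.sum_le_sum fun i _ => (Nat.lt_floor_add_one _).le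
      _ = _ := by simp [Finset.sum_add_distrib]
  · refine Finset.sum_le_sum fun i _ => Nat.floor_le ?_
    have := (irrational_gaussMap_iterate hx hi (2 * i)).1.1
    positivity

theorem tendsto_floor_mul_div_log {θ : ℝ} (hθ : 0 < θ) :
    Tendsto (fun n : ℕ => ⌊θ * (n / Real.log n)⌋₊) atTop atTop ∧
    Tendsto (fun n : ℕ => (⌊θ * (n / Real.log n)⌋₊ : ℝ) * (Real.log n / n)) atTop (nhds θ) ∧
    Tendsto (fun n : ℕ => (⌊θ * (n / Real.log n)⌋₊ : ℝ) *
      Real.log ⌊θ * (n / Real.log n)⌋₊ / n) atTop (nhds θ) := by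
  have hn : Tendsto (fun n : ℕ => (n : ℝ)) atTop atTop := tendsto_natCast_atTop_atTop
  have hL : Tendsto (fun n : ℕ => Real.log n) atTop atTop := Real.tendsto_log_atTop.comp hn
  have hx : Tendsto (fun n : ℕ => θ * (n / Real.log n)) atTop atTop := by
    refine Tendsto.const_mul_atTop hθ ?_
    have h0 : Tendsto (fun n : ℕ => Real.log n / n) atTop (nhdsWithin 0 (Set.Ioi 0)) := by
      refine tendsto_nhdsWithin_iff.2
        ⟨Real.isLittleO_log_id_atTop.tendsto_div_nhds_zero.comp hn, ?_⟩
      filter_upwards [hn.eventually_gt_atTop 0, hL.eventually_gt_atTop 0] with n h1 h2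
      exact div_pos h2 h1
    refine h0.inv_tendsto_nhdsGT_zero.congr fun n => ?_
    simp
  have hr : Tendsto (fun n : ℕ => (⌊θ * (n / Real.log n)⌋₊ : ℝ) / (θ * (n / Real.log n))) atTop
      (nhds 1) := (tendsto_nat_floor_div_atTop (R := ℝ)).comp hx
  have hκ : Tendsto (fun n : ℕ => ⌊θ * (n / Real.log n)⌋₊) atTop atTop :=
    tendsto_nat_floor_atTop.comp hx
  have h2 : Tendsto (fun n : ℕ => (⌊θ * (n / Real.log n)⌋₊ : ℝ) * (Real.log n / n)) atTop
      (nhds θ) := by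
    have := hr.mul_const θ
    rw [one_mul] at this
    refine this.congr' ?_
    filter_upwards [hn.eventually_gt_atTop 0, hL.eventually_gt_atTop 0] with n h1 h2
    field_simp
  refine ⟨hκ, h2, ?_⟩
  have hlogr : Tendsto (fun n : ℕ =>
      Real.log ((⌊θ * (n / Real.log n)⌋₊ : ℝ) / (θ * (n / Real.log n)))) atTop (nhds 0) := by
    simpa using hr.log one_ne_zero
  have hloglog : Tendsto (fun n : ℕ => Real.log (Real.log n) / Real.log n) atTop (nhds 0) :=
    Real.isLittleO_log_id_atTop.tendsto_div_nhds_zero.comp hL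
  have h3 : Tendsto (fun n : ℕ => Real.log ⌊θ * (n / Real.log n)⌋₊ / Real.log n) atTop
      (nhds 1) := by
    have := (((hlogr.add_const (Real.log θ)).mul (tendsto_inv_atTop_zero.comp hL)).add_const 1).sub
      hloglog
    simp only [mul_zero, zero_add, sub_zero] at this
    refine this.congr' ?_
    filter_upwards [hn.eventually_gt_atTop 0, hL.eventually_gt_atTop 0,
      hκ.eventually_gt_atTop 0] with n h1 h2 h3
    have h3' : (⌊θ * (n / Real.log n)⌋₊ : ℝ) ≠ 0 := by exact_mod_cast h3.ne'
    rw [Real.log_div h3' (by positivity), Real.log_mul hθ.ne' (by positivity),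
      Real.log_div h1.ne' h2.ne']
    simp only [Function.comp]
    field_simp
    ring
  have := h2.mul h3
  rw [mul_one] at this
  refine this.congr' ?_
  filter_upwards [hL.eventually_gt_atTop 0] with n h2
  field_simp

theorem tendsto_log_succ_mul_log_div :
    Tendsto (fun n : ℕ => Real.log n / n * Real.log (n + 1)) atTop (nhds 0) := by
  have hn : Tendsto (fun n : ℕ => (n : ℝ)) atTop atTop := tendsto_natCast_atTop_atTop
  have hn1 : Tendsto (fun n : ℕ => (n : ℝ) + 1) atTop atTop := tendsto_atTop_add_const_right _ _ hn
  have h1 : Tendsto (fun n : ℕ => Real.log (n + 1) ^ 2 / (1 * ((n : ℝ) + 1) + -1)) atTop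
      (nhds 0) := (Real.tendsto_pow_log_div_mul_add_atTop 1 (-1) 2 one_ne_zero).comp hn1
  refine squeeze_zero' ?_ ?_ h1
  · filter_upwards [eventually_ge_atTop 1] with n hn
    have : (1 : ℝ) ≤ n := by exact_mod_cast hn
    have h1 := Real.log_nonneg this
    have h2 := Real.log_nonneg (this.trans (by linarith : (n : ℝ) ≤ n + 1))
    positivity
  · filter_upwards [eventually_ge_atTop 1] with n hn
    have : (1 : ℝ) ≤ n := by exact_mod_cast hn
    have h1 := Real.log_nonneg this
    have h2 := Real.log_le_log (by linarith) (by linarith : (n : ℝ) ≤ n + 1)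
    rw [one_mul, add_neg_cancel_right, div_mul_eq_mul_div, pow_two]
    gcongr
    linarith

/-- The exceptional set for the weak law of large numbers for `∑ 1 / Gⁱ x`. -/
def invSumDeviation (η : ℝ) (k : ℕ) : Set ℝ :=
  {x | η ≤ |(∑ i ∈ Finset.range k, 1 / gaussMap^[2 * i] x) / (k * Real.log k) - 1 / Real.log 2|}

/-- The exceptional set for the weak law of large numbers for `∑ -log Gʲ x`. -/
def logSumDeviation (η : ℝ) (k : ℕ) : Set ℝ :=
  {x | η ≤ |(∑ j ∈ Finset.range k, -Real.log (gaussMap^[j] x)) / k - π ^ 2 / 12 / Real.log 2|}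

theorem log_negQ_le_of_notMem {x : ℝ} (hx : x ∈ Set.Ioo (0 : ℝ) 1) (hi : Irrational x) {n k : ℕ}
    {η η' : ℝ} (hk : 1 < k) (hA : x ∉ invSumDeviation η k) (hB : x ∉ logSumDeviation η' (2 * k))
    (hn : (n : ℝ) ≤ k * Real.log k * (1 / Real.log 2 - η) - k) :
    Real.log (negQ x (n + 1)) ≤ 2 * k * (π ^ 2 / 12 / Real.log 2 + η') + Real.log (n + 1) := by
  simp only [invSumDeviation, logSumDeviation, Set.mem_ofPred_eq, not_le] at hA hB
  have hk1 : (1 : ℝ) < k := by exact_mod_cast hk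
  have hpos : 0 < (k : ℝ) * Real.log k := mul_pos (by linarith) (Real.log_pos hk1)
  have hA' := (abs_lt.1 hA).1
  have hB' := (abs_lt.1 hB).2
  rw [sub_lt_iff_lt_add, div_lt_iff₀ (by push_cast; linarith)] at hB'
  rw [lt_sub_iff_add_lt, lt_div_iff₀ hpos] at hA'
  have hnt : n ≤ excursionTime k x := by
    have := (excursionTime_bounds hx hi k).1
    have : (n : ℝ) ≤ excursionTime k x := by linarith
    exact_mod_cast this
  have h1 := birkhoffSum_negT_mono hx hi hnt
  simp only at h1
  rw [(birkhoffSum_excursionTime hx hi k).2] at h1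
  have h2 := (log_negQ_bounds hx hi n).2
  push_cast at hB'
  linarith

theorem le_log_negQ_of_notMem {x : ℝ} (hx : x ∈ Set.Ioo (0 : ℝ) 1) (hi : Irrational x) {n k : ℕ}
    {η η' : ℝ} (hk : 1 < k) (hA : x ∉ invSumDeviation η k) (hB : x ∉ logSumDeviation η' (2 * k))
    (hn : k * Real.log k * (1 / Real.log 2 + η) ≤ n) :
    2 * k * (π ^ 2 / 12 / Real.log 2 - η') ≤ Real.log (negQ x (n + 1)) := by
  simp only [invSumDeviation, logSumDeviation, Set.mem_ofPred_eq, not_le] at hA hB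
  have hk1 : (1 : ℝ) < k := by exact_mod_cast hk
  have hpos : 0 < (k : ℝ) * Real.log k := mul_pos (by linarith) (Real.log_pos hk1)
  have hA' := (abs_lt.1 hA).2
  have hB' := (abs_lt.1 hB).1
  rw [lt_sub_iff_add_lt, lt_div_iff₀ (by push_cast; linarith)] at hB'
  rw [sub_lt_iff_lt_add, div_lt_iff₀ hpos] at hA'
  have hnt : excursionTime k x ≤ n := by
    have := (excursionTime_bounds hx hi k).2
    have : (excursionTime k x : ℝ) ≤ n := by linarith
    exact_mod_cast this
  have h1 := birkhoffSum_negT_mono hx hi hnt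
  simp only at h1
  rw [(birkhoffSum_excursionTime hx hi k).2] at h1
  have h2 := (log_negQ_bounds hx hi n).1
  push_cast at hB'
  linarith

/-- `(log n / n) · log Qₙ → π²/6` in measure.  (Recall `negQ x (n+1) = Qₙ`.) -/
theorem negCF_log_denominator_in_measure :
    ∀ ε > (0 : ℝ), Tendsto
      (fun n : ℕ => volume {x : ℝ | x ∈ Set.Ioo (0 : ℝ) 1 ∧ Irrational x ∧
        |Real.log n / n * Real.log (negQ x (n + 1)) - Real.pi ^ 2 / 6| > ε})
      atTop (nhds 0) := by
  intro ε hε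
  have hlog : 0 < Real.log 2 := Real.log_pos one_lt_two
  set c := Real.pi ^ 2 / 6 with hc
  have hc0 : 0 < c := by positivity
  obtain ⟨δ, hδ0, hδ1, hδε⟩ : ∃ δ : ℝ, 0 < δ ∧ δ < 1 ∧ δ * c ≤ ε / 4 :=
    ⟨min (1 / 2) (ε / (4 * c)), by positivity, by
      have := min_le_left (1 / 2) (ε / (4 * c)); linarith, by
      calc _ ≤ ε / (4 * c) * c := by gcongr; exact min_le_right _ _
        _ = ε / 4 := by field_simp⟩
  set η := δ / 2 / Real.log 2 with hη
  set η' := ε / 16 / Real.log 2 with hη'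
  have hη0 : 0 < η := by positivity
  have hη'0 : 0 < η' := by positivity
  have hp0 : 0 < Real.log 2 * (1 + δ) := by positivity
  have hm0 : 0 < Real.log 2 * (1 - δ) := mul_pos hlog (by linarith)
  set kp : ℕ → ℕ := fun n => ⌊Real.log 2 * (1 + δ) * (n / Real.log n)⌋₊ with hkp
  set km : ℕ → ℕ := fun n => ⌊Real.log 2 * (1 - δ) * (n / Real.log n)⌋₊ with hkm
  obtain ⟨p1, p2, p3⟩ := tendsto_floor_mul_div_log hp0
  obtain ⟨m1, m2, m3⟩ := tendsto_floor_mul_div_log hm0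
  have hL : Tendsto (fun n : ℕ => Real.log n) atTop atTop :=
    Real.tendsto_log_atTop.comp tendsto_natCast_atTop_atTop
  have two_mul_atTop : Tendsto (fun k : ℕ => 2 * k) atTop atTop :=
    tendsto_atTop_mono (fun k => by simp only [id]; omega) tendsto_id
  have hbad : Tendsto (fun n => ENNReal.ofReal (2 * Real.log 2) *
      (gaussMeasure (invSumDeviation η (kp n)) + gaussMeasure (logSumDeviation η' (2 * kp n)) +
        (gaussMeasure (invSumDeviation η (km n)) + gaussMeasure (logSumDeviation η' (2 * km n)))))
      atTop (nhds 0) := by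
    have hA := tendsto_gaussMeasure_inv_sum hη0
    have hB := (tendsto_gaussMeasure_neg_log_sum hη'0).comp two_mul_atTop
    have := ENNReal.Tendsto.const_mul (a := ENNReal.ofReal (2 * Real.log 2))
      (((hA.comp p1).add (hB.comp p1)).add ((hA.comp m1).add (hB.comp m1)))
      (Or.inr ENNReal.ofReal_ne_top)
    simp only [add_zero, mul_zero] at this
    exact this
  have e1 : ∀ᶠ n : ℕ in atTop,
      (n : ℝ) ≤ kp n * Real.log (kp n) * (1 / Real.log 2 - η) - kp n := by
    have h1 : Tendsto (fun n : ℕ => (kp n : ℝ) * Real.log (kp n) / n * (1 / Real.log 2 - η) -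
        kp n * (Real.log n / n) * (Real.log n)⁻¹) atTop (nhds
        (Real.log 2 * (1 + δ) * (1 / Real.log 2 - η) - Real.log 2 * (1 + δ) * 0)) :=
      (p3.mul_const _).sub (p2.mul (tendsto_inv_atTop_zero.comp hL))
    have h2 : 1 < Real.log 2 * (1 + δ) * (1 / Real.log 2 - η) - Real.log 2 * (1 + δ) * 0 := by
      have : Real.log 2 * (1 + δ) * (1 / Real.log 2 - η) - Real.log 2 * (1 + δ) * 0 =
          (1 + δ) * (1 - δ / 2) := by rw [hη]; field_simp; ring
      rw [this]
      nlinarith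
    filter_upwards [h1.eventually (lt_mem_nhds h2), hL.eventually_gt_atTop 0,
      eventually_gt_atTop 0] with n h3 h4 h5
    have h5' : (0 : ℝ) < n := by exact_mod_cast h5
    have h6 : (kp n : ℝ) * Real.log (kp n) / n * (1 / Real.log 2 - η) -
        kp n * (Real.log n / n) * (Real.log n)⁻¹ =
        (kp n * Real.log (kp n) * (1 / Real.log 2 - η) - kp n) / n := by
      field_simp
    rw [h6, lt_div_iff₀ h5', one_mul] at h3
    exact h3.le
  have e2 : ∀ᶠ n : ℕ in atTop, km n * Real.log (km n) * (1 / Real.log 2 + η) ≤ n := by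
    have h1 : Tendsto (fun n : ℕ => (km n : ℝ) * Real.log (km n) / n * (1 / Real.log 2 + η)) atTop
        (nhds (Real.log 2 * (1 - δ) * (1 / Real.log 2 + η))) := m3.mul_const _
    have h2 : Real.log 2 * (1 - δ) * (1 / Real.log 2 + η) < 1 := by
      have : Real.log 2 * (1 - δ) * (1 / Real.log 2 + η) = (1 - δ) * (1 + δ / 2) := by
        rw [hη]; field_simp
      rw [this]
      nlinarith
    filter_upwards [h1.eventually (gt_mem_nhds h2), eventually_gt_atTop 0] with n h3 h5
    have h5' : (0 : ℝ) < n := by exact_mod_cast h5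
    rw [div_mul_eq_mul_div, div_lt_iff₀ h5', one_mul] at h3
    exact h3.le
  have e3 : ∀ᶠ n : ℕ in atTop, Real.log n / n *
      (2 * kp n * (π ^ 2 / 12 / Real.log 2 + η') + Real.log (n + 1)) ≤ c + ε := by
    have h1 : Tendsto (fun n : ℕ => (kp n : ℝ) * (Real.log n / n) *
        (2 * (π ^ 2 / 12 / Real.log 2 + η')) + Real.log n / n * Real.log (n + 1)) atTop (nhds
        (Real.log 2 * (1 + δ) * (2 * (π ^ 2 / 12 / Real.log 2 + η')) + 0)) :=
      (p2.mul_const _).add tendsto_log_succ_mul_log_div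
    have h2 : Real.log 2 * (1 + δ) * (2 * (π ^ 2 / 12 / Real.log 2 + η')) + 0 < c + ε := by
      have : Real.log 2 * (1 + δ) * (2 * (π ^ 2 / 12 / Real.log 2 + η')) + 0 =
          (1 + δ) * (c + ε / 8) := by rw [hη', hc]; field_simp; ring
      rw [this]
      nlinarith
    filter_upwards [h1.eventually (gt_mem_nhds h2)] with n h3
    linarith
  have e4 : ∀ᶠ n : ℕ in atTop,
      c - ε ≤ Real.log n / n * (2 * km n * (π ^ 2 / 12 / Real.log 2 - η')) := by
    have h1 : Tendsto (fun n : ℕ => (km n : ℝ) * (Real.log n / n) *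
        (2 * (π ^ 2 / 12 / Real.log 2 - η'))) atTop (nhds
        (Real.log 2 * (1 - δ) * (2 * (π ^ 2 / 12 / Real.log 2 - η')))) := m2.mul_const _
    have h2 : c - ε < Real.log 2 * (1 - δ) * (2 * (π ^ 2 / 12 / Real.log 2 - η')) := by
      have : Real.log 2 * (1 - δ) * (2 * (π ^ 2 / 12 / Real.log 2 - η')) =
          (1 - δ) * (c - ε / 8) := by rw [hη', hc]; field_simp; ring
      rw [this]
      nlinarith
    filter_upwards [h1.eventually (lt_mem_nhds h2)] with n h3
    linarith
  refine tendsto_of_tendsto_of_tendsto_of_le_of_le' tendsto_const_nhds hbad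
    (Eventually.of_forall fun _ => zero_le) ?_
  filter_upwards [e1, e2, e3, e4, p1.eventually_gt_atTop 1, m1.eventually_gt_atTop 1]
    with n h1 h2 h3 h4 hp hm
  have hcoef : 0 ≤ Real.log n / n := by positivity
  calc _ ≤ volume ((invSumDeviation η (kp n) ∪ logSumDeviation η' (2 * kp n) ∪
        (invSumDeviation η (km n) ∪ logSumDeviation η' (2 * km n))) ∩ Set.Ioc 0 1) := by
        refine measure_mono ?_
        rintro x ⟨hx, hi, hx'⟩
        refine ⟨?_, hx.1, hx.2.le⟩
        by_contra hnot
        simp only [Set.mem_union, not_or] at hnot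
        obtain ⟨⟨hA, hB⟩, hA', hB'⟩ := hnot
        have hu := mul_le_mul_of_nonneg_left (log_negQ_le_of_notMem hx hi hp hA hB h1) hcoef
        have hl := mul_le_mul_of_nonneg_left (le_log_negQ_of_notMem hx hi hm hA' hB' h2) hcoef
        refine absurd hx' (not_lt.2 (abs_le.2 ⟨?_, ?_⟩)) <;> linarith
    _ ≤ _ := (volume_inter_le_gaussMeasure _).trans (by
        gcongr
        exact (measure_union_le _ _).trans
          (add_le_add (measure_union_le _ _) (measure_union_le _ _)))
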